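/- arXiv:math-ph/0508044 — 3 statements merged into one kernel-verified Lean document; each statement's English description precedes it below -/
import Mathlib

section
/- Let ν₀, ν₁ : [0,∞) → [0,∞) be nonincreasing functions with ∫₀^∞ ν₁(r) dr < ∞ and ∫₀^∞ ν₀(r)/(1+r) dr < ∞. Then for every x ∈ ℝ³, (1/(4πt)²) ∫_{S_t(x)} ∫_{S_t(x)} (1/t) [ 4 ν₁(|x' − x''|) + (1/t) ν₀(|x' − x''|) ] dS(x') dS(x'') → 0 as t → ∞. -/
open MeasureTheory Filter
open scoped ENNReal

theorem anti_patch (i : Fin 3) (s : ℝ) (hs : s = 1 ∨ s = -1) (x : EuclideanSpace ℝ (Fin 3)) (t : ℝ) (ht : 0 < t)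
    (y z : EuclideanSpace ℝ (Fin 3)) (hy : y ∈ Metric.sphere x t) (hz : z ∈ Metric.sphere x t)
    (hyi : t / 2 ≤ s * (y i - x i)) (hzi : t / 2 ≤ s * (z i - x i)) (D : ℝ)
    (hD : ∀ j : Fin 2, |y (i.succAbove j) - z (i.succAbove j)| ≤ D) : dist y z ≤ 5 * D := by
  have hD0 : 0 ≤ D := (abs_nonneg _).trans (hD 0)
  have key : ∀ a b c a' b' c' : ℝ, a^2+b^2+c^2 = t^2 → a'^2+b'^2+c'^2 = t^2 → t/2 ≤ s * a → t/2 ≤ s * a' →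
      |b - b'| ≤ D → |c - c'| ≤ D → (a-a')^2 + (b-b')^2 + (c-c')^2 ≤ (5*D)^2 := by
    intro a b c a' b' c' h h' ha ha' hb hc
    have b1 : |b + b'| ≤ 2 * t := by
      have := abs_le_of_sq_le_sq (a := b) (b := t) (by nlinarith) ht.le
      have := abs_le_of_sq_le_sq (a := b') (b := t) (by nlinarith) ht.le
      have := abs_add_le b b'
      grind
    have c1 : |c + c'| ≤ 2 * t := by
      have := abs_le_of_sq_le_sq (a := c) (b := t) (by nlinarith) ht.le
      have := abs_le_of_sq_le_sq (a := c') (b := t) (by nlinarith) ht.le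
      have := abs_add_le c c'
      grind
    have a1 : t ≤ |a + a'| := by
      rcases hs with rfl | rfl
      · exact le_trans (by linarith) (le_abs_self _)
      · exact le_trans (by linarith) (neg_le_abs _)
    have e : |a - a'| * |a + a'| ≤ D * (2*t) + D * (2*t) := by
      rw [← abs_mul]
      have : (a - a') * (a+a') = -((b-b')*(b+b') + (c-c')*(c+c')) := by nlinarith
      rw [this, abs_neg]
      refine (abs_add_le _ _).trans ?_
      rw [abs_mul, abs_mul]
      gcongr
    have e2 : |a - a'| ≤ 4 * D := by
      have : |a - a'| * t ≤ (4*D) * t := by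
        have := mul_le_mul_of_nonneg_left a1 (abs_nonneg (a-a'))
        linarith
      exact le_of_mul_le_mul_right this ht
    have := sq_le_sq' (abs_le.1 e2).1 (abs_le.1 e2).2
    have := sq_le_sq' (abs_le.1 hb).1 (abs_le.1 hb).2
    have := sq_le_sq' (abs_le.1 hc).1 (abs_le.1 hc).2
    nlinarith
  rw [EuclideanSpace.dist_eq]
  apply Real.sqrt_le_iff.2 ⟨by positivity, ?_⟩
  rw [Metric.mem_sphere, EuclideanSpace.dist_eq, Real.sqrt_eq_iff_mul_self_eq_of_pos ht] at hy hz
  simp only [Real.dist_eq, sq_abs, Fin.sum_univ_three] at hy hz ⊢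
  have h0 := hD 0
  have h1 := hD 1
  have := key (y i - x i) (y (i.succAbove 0) - x (i.succAbove 0)) (y (i.succAbove 1) - x (i.succAbove 1))
     (z i - x i) (z (i.succAbove 0) - x (i.succAbove 0)) (z (i.succAbove 1) - x (i.succAbove 1)) 
     (by fin_cases i <;> simp [Fin.succAbove] <;> linarith)
     (by fin_cases i <;> simp [Fin.succAbove] <;> linarith) hyi hzi (by simpa using h0) (by simpa using h1)
  fin_cases i <;> simp [Fin.succAbove] at this ⊢ <;> linarith

theorem patch_meas (i : Fin 3) (s : ℝ) (hs : s = 1 ∨ s = -1) (x p : EuclideanSpace ℝ (Fin 3)) (t r : ℝ) (ht : 0 < t) (hr : 0 ≤ r) :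
    μH[2] {y | y ∈ Metric.sphere x t ∩ Metric.closedBall p r ∧ t / 2 ≤ s * (y i - x i)} ≤ ENNReal.ofReal (100 * r^2) := by
  set S := {y | y ∈ Metric.sphere x t ∩ Metric.closedBall p r ∧ t / 2 ≤ s * (y i - x i)} with hS
  let f : EuclideanSpace ℝ (Fin 3) → (Fin 2 → ℝ) := fun y j => y (i.succAbove j)
  have ha : AntilipschitzWith 5 (fun y : S => f y) := by
    apply AntilipschitzWith.of_le_mul_dist
    intro y z
    refine anti_patch i s hs x t ht y z y.2.1.1 z.2.1.1 y.2.2 z.2.2 _ ?_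
    intro j
    exact dist_le_pi_dist (f y) (f z) j
  have h1 := ha.hausdorffMeasure_preimage_le (d := 2) (by norm_num) (Metric.closedBall (f p) r)
  have h2 : (fun y : S => f y) ⁻¹' (Metric.closedBall (f p) r) = Set.univ := by
    ext y
    simp only [Set.mem_preimage, Set.mem_univ, iff_true, Metric.mem_closedBall]
    rw [dist_pi_le_iff hr]
    intro j
    refine le_trans ?_ (Metric.mem_closedBall.1 y.2.1.2)
    rw [EuclideanSpace.dist_eq]
    apply Real.le_sqrt_of_sq_le
    exact Finset.single_le_sum (f := fun k => dist (y.1 k) (p k)^2) (fun k _ => sq_nonneg _) (Finset.mem_univ (i.succAbove j))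
  rw [h2] at h1
  have h3 := (isometry_subtype_coe (s := S)).hausdorffMeasure_image (d := 2) (Or.inl (by norm_num)) Set.univ
  rw [Set.image_univ, Subtype.range_coe] at h3
  rw [h3]
  refine h1.trans ?_
  have h4 : (μH[2] : Measure (Fin 2 → ℝ)) = volume := by
    have := hausdorffMeasure_pi_real (ι := Fin 2)
    simpa using this
  rw [h4, Real.volume_pi_closedBall _ hr]
  have : ((5 : NNReal) : ℝ≥0∞) ^ (2:ℝ) = ENNReal.ofReal 25 := by
    norm_num [← ENNReal.rpow_natCast]
  rw [this, ← ENNReal.ofReal_mul (by norm_num)]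
  apply ENNReal.ofReal_le_ofReal
  simp
  nlinarith

theorem cap_meas (x p : EuclideanSpace ℝ (Fin 3)) (t r : ℝ) (ht : 0 < t) (hr : 0 ≤ r) :
    μH[2] (Metric.sphere x t ∩ Metric.closedBall p r) ≤ ENNReal.ofReal (600 * r^2) := by
  let P : Fin 3 × Bool → Set (EuclideanSpace ℝ (Fin 3)) := fun q => 
     {y | y ∈ Metric.sphere x t ∩ Metric.closedBall p r ∧ t / 2 ≤ (if q.2 then 1 else -1) * (y q.1 - x q.1)}
  have hsub : Metric.sphere x t ∩ Metric.closedBall p r ⊆ ⋃ q, P q := by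
    intro y hy
    simp only [Set.mem_iUnion]
    by_contra! hcon
    have h1 := fun i => hcon (i, true)
    have h2 := fun i => hcon (i, false)
    simp only [P, Set.mem_setOf_eq, hy, true_and, not_le] at h1 h2
    have hy' := hy.1
    rw [Metric.mem_sphere, EuclideanSpace.dist_eq, Real.sqrt_eq_iff_mul_self_eq_of_pos ht] at hy'
    simp only [Real.dist_eq, sq_abs, Fin.sum_univ_three] at hy'
    have h3 : ∀ i, (y i - x i)^2 ≤ (t/2)^2 := by
      intro i
      have := h1 i
      have := h2 i
      simp at *
      apply sq_le_sq' <;> linarith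
    have := h3 0
    have := h3 1
    have := h3 2
    nlinarith
  refine (measure_mono hsub).trans ((measure_iUnion_le P).trans ?_)
  rw [tsum_fintype]
  refine (Finset.sum_le_card_nsmul _ _ (ENNReal.ofReal (100*r^2)) ?_).trans ?_
  · rintro ⟨i, b⟩ -
    exact patch_meas i _ (by cases b <;> simp) x p t r ht hr
  · simp only [Finset.card_univ, Fintype.card_prod, Fintype.card_fin, Fintype.card_bool]
    rw [← ENNReal.ofReal_nsmul]
    apply ENNReal.ofReal_le_ofReal
    simp; nlinarith

theorem decay_one (ν : ℝ → ℝ) (h0 : ∀ r, 0 ≤ r → 0 ≤ ν r) (hm : AntitoneOn ν (Set.Ici 0))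
    (hi : IntegrableOn ν (Set.Ioi 0)) (ε : ℝ) (hε : 0 < ε) :
    ∃ R, 0 < R ∧ ∀ r, R ≤ r → ν r ≤ ε / r := by
  have h1 := intervalIntegral_tendsto_integral_Ioi (f := ν) 0 hi tendsto_id
  have h2 := h1.comp (tendsto_id.atTop_div_const (show (0:ℝ) < 2 by norm_num))
  have h3 := h1.sub h2
  rw [sub_self] at h3
  have h4 := h3.eventually (gt_mem_nhds (show (0:ℝ) < ε/2 by positivity))
  obtain ⟨R, hR⟩ := (h4.and (eventually_gt_atTop 0)).exists_forall_of_atTop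
  refine ⟨max R 1, by positivity, fun r hr => ?_⟩
  obtain ⟨h5, h6⟩ := hR r ((le_max_left _ _).trans hr)
  simp only [Function.comp, id] at h5
  have ii : ∀ a b : ℝ, 0 ≤ a → 0 ≤ b → IntervalIntegrable ν volume a b := by
    intro a b ha hb
    constructor
    · exact hi.mono_set (fun u hu => lt_of_le_of_lt ha hu.1)
    · exact hi.mono_set (fun u hu => lt_of_le_of_lt hb hu.1)
  rw [intervalIntegral.integral_interval_sub_left (ii _ _ le_rfl h6.le) (ii _ _ le_rfl (by positivity))] at h5
  have h7 : ∫ u in (r/2)..r, ν r ≤ ∫ u in (r/2)..r, ν u := by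
    apply intervalIntegral.integral_mono_on (by linarith) (by simp) (ii _ _ (by positivity) h6.le)
    intro u hu
    exact hm (show (0:ℝ) ≤ u by linarith [hu.1]) (show (0:ℝ) ≤ r from h6.le) hu.2
  simp at h7
  rw [le_div_iff₀ h6]
  nlinarith

theorem decay_zero (ν : ℝ → ℝ) (h0 : ∀ r, 0 ≤ r → 0 ≤ ν r) (hm : AntitoneOn ν (Set.Ici 0))
    (hi : IntegrableOn (fun r => ν r / (1 + r)) (Set.Ioi 0)) (ε : ℝ) (hε : 0 < ε) :
    ∃ R, 0 < R ∧ ∀ r, R ≤ r → ν r ≤ ε := by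
  by_contra! hcon
  have hge : ∀ r, 0 < r → ε ≤ ν r := by
    intro r hr
    obtain ⟨q, hq, hq'⟩ := hcon r hr
    exact hq'.le.trans (hm (show (0:ℝ) ≤ r from hr.le) (show (0:ℝ) ≤ q from hr.le.trans hq) hq)
  apply not_integrableOn_Ioi_inv (a := 1)
  have hi' := (hi.mono_set (Set.Ioi_subset_Ioi (zero_le_one))).const_mul (2/ε)
  refine Integrable.mono' hi' (by fun_prop) ?_
  refine (ae_restrict_iff' measurableSet_Ioi).2 (ae_of_all _ ?_)
  intro r hr
  have hr : (1:ℝ) < r := hr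
  have := hge r (by linarith)
  rw [Real.norm_of_nonneg (by positivity), inv_eq_one_div]
  have e : 2/ε * (ν r / (1+r)) = (2 * (ν r / ε)) / (1+r) := by ring
  rw [e, div_le_div_iff₀ (by linarith) (by linarith)]
  have : 1 ≤ ν r / ε := by rwa [le_div_iff₀ hε, one_mul]
  nlinarith

noncomputable def shellG (p : EuclideanSpace ℝ (Fin 3)) (t : ℝ) (k : ℕ) :
    EuclideanSpace ℝ (Fin 3) → ℝ≥0∞ :=
  (Metric.closedBall p (2 * t / 2^k)).indicator (fun _ => ENNReal.ofReal (2^k / t))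

theorem shell_lower (p y : EuclideanSpace ℝ (Fin 3)) (t : ℝ) (ht : 0 < t)
    (h1 : 0 < dist p y) (h2 : dist p y ≤ 2 * t) :
    ENNReal.ofReal (1 / dist p y) ≤ ∑' k, shellG p t k y := by
  obtain ⟨k, hk, hk'⟩ := exists_nat_pow_near (x := 2 * t / dist p y) (y := 2)
    ((one_le_div h1).2 h2) (by norm_num)
  refine le_trans ?_ (ENNReal.le_tsum k)
  have h2k : (0:ℝ) < 2^k := by positivity
  rw [le_div_iff₀ h1] at hk
  rw [div_lt_iff₀ h1, pow_succ] at hk'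
  rw [shellG, Set.indicator_of_mem]
  · apply ENNReal.ofReal_le_ofReal
    rw [div_le_div_iff₀ h1 ht]
    nlinarith
  · rw [Metric.mem_closedBall, dist_comm, le_div_iff₀ h2k]
    linarith

theorem shell_int (x p : EuclideanSpace ℝ (Fin 3)) (t : ℝ) (ht : 0 < t) :
    ∫⁻ y in Metric.sphere x t, ∑' k, shellG p t k y ∂(μH[2]) ≤ ENNReal.ofReal (4800 * t) := by
  rw [lintegral_tsum]
  · have hk : ∀ k, ∫⁻ y in Metric.sphere x t, shellG p t k y ∂(μH[2]) ≤ ENNReal.ofReal (2400 * t * (1/2)^k) := by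
      intro k
      unfold shellG
      rw [lintegral_indicator Metric.isClosed_closedBall.measurableSet, setLIntegral_const,
        Measure.restrict_apply Metric.isClosed_closedBall.measurableSet, Set.inter_comm]
      refine (mul_le_mul_right (cap_meas x p t _ ht (by positivity)) _).trans ?_
      rw [← ENNReal.ofReal_mul (by positivity)]
      apply ENNReal.ofReal_le_ofReal
      apply le_of_eq
      rw [one_div_pow]
      field_simp
      ring
    refine (ENNReal.tsum_le_tsum hk).trans ?_
    rw [← ENNReal.ofReal_tsum_of_nonneg (fun _ => by positivity) (summable_geometric_two.mul_left _), tsum_mul_left, tsum_geometric_two]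
    apply ENNReal.ofReal_le_ofReal
    linarith
  · intro k
    exact (measurable_const.indicator Metric.isClosed_closedBall.measurableSet).aemeasurable

theorem sphere_meas (x : EuclideanSpace ℝ (Fin 3)) (t : ℝ) (ht : 0 < t) :
    μH[2] (Metric.sphere x t) ≤ ENNReal.ofReal (600 * t^2) := by
  have := cap_meas x x t t ht ht.le
  rwa [Set.inter_eq_self_of_subset_left Metric.sphere_subset_closedBall] at this

theorem inner_bound (f : EuclideanSpace ℝ (Fin 3) → ℝ) (x p : EuclideanSpace ℝ (Fin 3)) (t R a b c : ℝ)
    (ht : 0 < t) (hR : 0 < R) (ha : 0 ≤ a) (hb : 0 ≤ b) (hc : 0 ≤ c) (hp : p ∈ Metric.sphere x t)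
    (hf0 : ∀ y, 0 ≤ f y)
    (hf1 : ∀ y, dist p y ≤ R → f y ≤ a) (hf2 : ∀ y, R < dist p y → f y ≤ b * (1 / dist p y) + c) :
    ‖∫ y in Metric.sphere x t, f y ∂(μH[2])‖ ≤ a * (600 * R^2) + b * (4800 * t) + c * (600 * t^2) := by
  have hB : 0 ≤ a * (600 * R^2) + b * (4800 * t) + c * (600 * t^2) := by positivity
  have h := enorm_integral_le_lintegral_enorm (μ := (μH[2] : Measure (EuclideanSpace ℝ (Fin 3))).restrict (Metric.sphere x t)) f
  rw [← ofReal_norm_eq_enorm] at h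
  refine (ENNReal.ofReal_le_ofReal_iff hB).1 (h.trans ?_)
  have hmb : MeasurableSet (Metric.closedBall p R) := Metric.isClosed_closedBall.measurableSet
  have hms : MeasurableSet (Metric.sphere x t) := Metric.isClosed_sphere.measurableSet
  calc _ ≤ ∫⁻ y in Metric.sphere x t, ((Metric.closedBall p R).indicator (fun _ => ENNReal.ofReal a) y
        + ENNReal.ofReal b * (∑' k, shellG p t k y)) + ENNReal.ofReal c ∂(μH[2]) := by
        apply setLIntegral_mono' hms
        intro y hy
        rw [Real.enorm_of_nonneg (hf0 y)]
        by_cases hd : dist p y ≤ R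
        · rw [Set.indicator_of_mem (by rwa [Metric.mem_closedBall, dist_comm])]
          exact (ENNReal.ofReal_le_ofReal (hf1 y hd)).trans (le_self_add.trans le_self_add)
        · push Not at hd
          refine (ENNReal.ofReal_le_ofReal (hf2 y hd)).trans ?_
          rw [ENNReal.ofReal_add (by positivity) hc, ENNReal.ofReal_mul hb]
          gcongr
          refine le_trans ?_ le_add_self
          gcongr
          apply shell_lower p y t ht (hR.trans hd)
          have := dist_triangle_right p y x
          rw [Metric.mem_sphere] at hp hy
          linarith
    _ ≤ _ := by
        have hmG : Measurable (fun y => ∑' k, shellG p t k y) :=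
          Measurable.tsum (fun k => measurable_const.indicator Metric.isClosed_closedBall.measurableSet)
        rw [lintegral_add_right _ measurable_const, lintegral_add_left (measurable_const.indicator hmb),
          lintegral_const_mul _ hmG, setLIntegral_const, lintegral_indicator hmb, setLIntegral_const,
          Measure.restrict_apply hmb, Set.inter_comm,
          ENNReal.ofReal_add (by positivity) (by positivity), ENNReal.ofReal_add (by positivity) (by positivity),
          ENNReal.ofReal_mul ha, ENNReal.ofReal_mul hb, ENNReal.ofReal_mul hc]
        gcongr
        · exact cap_meas x p t R ht hR.le
        · exact shell_int x p t ht
        · exact sphere_meas x t ht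

/-- Lemma `lgibs` of the paper: for nonincreasing `ν₀, ν₁ : [0,∞) → [0,∞)` with
`∫₀^∞ ν₁(r) dr < ∞` and `∫₀^∞ ν₀(r)/(1+r) dr < ∞`, the normalized double spherical integral
`(1/(4πt)²) ∫∫_{S_t(x)²} (1/t)(4ν₁(|x'-x''|) + (1/t)ν₀(|x'-x''|)) dS dS` tends to `0`
as `t → ∞`. -/
theorem double_spherical_integral_tendsto_zero
    (ν₀ ν₁ : ℝ → ℝ)
    (h00 : ∀ r, 0 ≤ r → 0 ≤ ν₀ r) (h10 : ∀ r, 0 ≤ r → 0 ≤ ν₁ r)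
    (h0m : AntitoneOn ν₀ (Set.Ici 0)) (h1m : AntitoneOn ν₁ (Set.Ici 0))
    (h1i : MeasureTheory.IntegrableOn ν₁ (Set.Ioi 0))
    (h0i : MeasureTheory.IntegrableOn (fun r => ν₀ r / (1 + r)) (Set.Ioi 0))
    (x : EuclideanSpace ℝ (Fin 3)) :
    Tendsto (fun t : ℝ =>
        (1 / (4 * Real.pi * t) ^ 2) *
          ∫ x' in Metric.sphere x t,
            (∫ x'' in Metric.sphere x t,
              (1 / t) * (4 * ν₁ (dist x' x'') + (1 / t) * ν₀ (dist x' x'')) ∂(μH[2])) ∂(μH[2]))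
      atTop (nhds 0) := by
  have main : ∀ ε : ℝ, 0 < ε → ∃ A : ℝ, ∀ t : ℝ, 1 ≤ t →
      ‖(1 / (4 * Real.pi * t) ^ 2) *
          ∫ x' in Metric.sphere x t,
            (∫ x'' in Metric.sphere x t,
              (1 / t) * (4 * ν₁ (dist x' x'') + (1 / t) * ν₀ (dist x' x'')) ∂(μH[2])) ∂(μH[2])‖
        ≤ A / t + 600 * 19800 * ε := by
    intro ε hε
    obtain ⟨R1, hR1, hd1⟩ := decay_one ν₁ h10 h1m h1i ε hε
    obtain ⟨R0, hR0, hd0⟩ := decay_zero ν₀ h00 h0m h0i ε hε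
    set R := max R1 R0 with hRdef
    have hR : 0 < R := lt_max_of_lt_left hR1
    have n0 := h00 0 le_rfl
    have n1 := h10 0 le_rfl
    refine ⟨600 * ((4 * ν₁ 0 + ν₀ 0) * (600 * R^2)), fun t ht1 => ?_⟩
    have ht : 0 < t := by linarith
    have hinv : 1 / t ≤ 1 := by rw [div_le_one ht]; exact ht1
    set B := ((1/t) * (4 * ν₁ 0 + ν₀ 0)) * (600 * R^2) + (4 * ε / t) * (4800 * t) + (ε / t^2) * (600 * t^2) with hB
    have hB0 : 0 ≤ B := by positivity
    have hin : ∀ x' ∈ Metric.sphere x t, ‖∫ x'' in Metric.sphere x t,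
              (1 / t) * (4 * ν₁ (dist x' x'') + (1 / t) * ν₀ (dist x' x'')) ∂(μH[2])‖ ≤ B := by
      intro p hp
      apply inner_bound _ x p t R _ _ _ ht hR (by positivity) (by positivity) (by positivity) hp
      · intro y
        have := h00 _ (dist_nonneg (x := p) (y := y))
        have := h10 _ (dist_nonneg (x := p) (y := y))
        positivity
      · intro y _
        have u0 := h00 _ (dist_nonneg (x := p) (y := y))
        have v0 : ν₀ (dist p y) ≤ ν₀ 0 := h0m (Set.mem_Ici.2 le_rfl) (Set.mem_Ici.2 dist_nonneg) dist_nonneg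
        have v1 : ν₁ (dist p y) ≤ ν₁ 0 := h1m (Set.mem_Ici.2 le_rfl) (Set.mem_Ici.2 dist_nonneg) dist_nonneg
        gcongr
        nlinarith
      · intro y hy
        have v0 := hd0 _ ((le_max_right _ _).trans hy.le)
        have v1 := hd1 _ ((le_max_left _ _).trans hy.le)
        have hdp : 0 < dist p y := hR.trans hy
        calc _ ≤ (1/t) * (4 * (ε / dist p y) + (1/t) * ε) := by gcongr
          _ = _ := by field_simp
    have hfin : μH[2] (Metric.sphere x t) < ∞ := (sphere_meas x t ht).trans_lt ENNReal.ofReal_lt_top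
    have hout := norm_setIntegral_le_of_norm_le_const hfin hin
    have hreal : (μH[2] : Measure (EuclideanSpace ℝ (Fin 3))).real (Metric.sphere x t) ≤ 600 * t^2 :=
      ENNReal.toReal_le_of_le_ofReal (by positivity) (sphere_meas x t ht)
    rw [norm_mul, Real.norm_of_nonneg (by positivity)]
    have hpi : 1 / (4 * Real.pi * t)^2 ≤ 1 / t^2 := by
      apply one_div_le_one_div_of_le (by positivity)
      have := Real.pi_gt_three
      gcongr
      nlinarith
    calc _ ≤ 1 / t^2 * (B * (600 * t^2)) := by
            gcongr
            exact hout.trans (by gcongr)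
      _ = _ := by
            rw [hB]
            field_simp
            ring
  rw [Metric.tendsto_atTop]
  intro δ hδ
  obtain ⟨A, hA⟩ := main (δ / (2 * 600 * 19800)) (by positivity)
  have hlim : Tendsto (fun t : ℝ => A / t) atTop (nhds 0) := tendsto_const_nhds.div_atTop tendsto_id
  have hev := hlim.eventually (gt_mem_nhds (show (0:ℝ) < δ/2 by positivity))
  obtain ⟨N, hN⟩ := (hev.and (eventually_ge_atTop 1)).exists_forall_of_atTop
  refine ⟨N, fun t htN => ?_⟩
  obtain ⟨k1, k2⟩ := hN t htN
  rw [dist_zero_right]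
  refine (hA t k2).trans_lt ?_
  linarith
end

section
/- Let u : ℝ³ × ℝ → ℝ be twice continuously differentiable and satisfy the wave equation ∂²u/∂t²(x,t) = Δ_x u(x,t) for all (x,t) ∈ ℝ³ × ℝ. Then for every R > 0 and every t ∈ ℝ, ∫_{{|x| < R}} ( |∇_x u(x,t)|² + |∂_t u(x,t)|² ) dx ≤ ∫_{{|x| < R + |t|}} ( |∇_x u(x,0)|² + |∂_t u(x,0)|² ) dx. -/
open MeasureTheory

abbrev E3 := EuclideanSpace ℝ (Fin 3)

lemma slice_fderiv {f : E3 × ℝ → ℝ} (hf : ContDiff ℝ 1 f) (x v : E3) (s : ℝ) :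
    fderiv ℝ (fun y => f (y, s)) x v = fderiv ℝ f (x, s) (v, 0) := by
  have h1 : HasFDerivAt f (fderiv ℝ f (x, s)) (x, s) :=
    (hf.differentiable one_ne_zero _).hasFDerivAt
  have h2 : HasFDerivAt (fun y : E3 => (y, s)) (ContinuousLinearMap.inl ℝ E3 ℝ) x :=
    hasFDerivAt_prodMk_left x s
  have h3 := h1.comp x h2
  have h4 := h3.fderiv
  simp only [Function.comp_def] at h4
  rw [h4]
  simp

lemma slice_hasDerivAt {f : E3 × ℝ → ℝ} (hf : ContDiff ℝ 1 f) (x : E3) (s : ℝ) :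
    HasDerivAt (fun r => f (x, r)) (fderiv ℝ f (x, s) (0, 1)) s := by
  have h1 : HasFDerivAt f (fderiv ℝ f (x, s)) (x, s) :=
    (hf.differentiable one_ne_zero _).hasFDerivAt
  have h2 : HasFDerivAt (fun y : ℝ => (x, y)) (ContinuousLinearMap.inr ℝ E3 ℝ) s :=
    hasFDerivAt_prodMk_right x s
  have h3 := (h1.comp s h2).hasDerivAt
  simpa [Function.comp_def] using h3

lemma ibp {f g : E3 → ℝ} (hf : ContDiff ℝ 1 f) (hg : ContDiff ℝ 1 g) (hc : HasCompactSupport f)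
    (v : E3) : ∫ x, f x * fderiv ℝ g x v = - ∫ x, fderiv ℝ f x v * g x := by
  have cf : Continuous (fun x => fderiv ℝ f x v) :=
    (hf.continuous_fderiv one_ne_zero).clm_apply continuous_const
  have cg : Continuous (fun x => fderiv ℝ g x v) :=
    (hg.continuous_fderiv one_ne_zero).clm_apply continuous_const
  apply integral_mul_fderiv_eq_neg_fderiv_mul_of_integrable
  · exact (cf.mul hg.continuous).integrable_of_hasCompactSupport
      ((hc.fderiv_apply (𝕜 := ℝ) v).mul_right)
  · exact (hf.continuous.mul cg).integrable_of_hasCompactSupport hc.mul_right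
  · exact (hf.continuous.mul hg.continuous).integrable_of_hasCompactSupport hc.mul_right
  · exact fun x _ => hf.differentiable one_ne_zero x
  · exact fun x _ => hg.differentiable one_ne_zero x

noncomputable def wt (ψ : ℝ → ℝ) (c : ℝ) (z : E3 × ℝ) : ℝ := ψ ((c - z.2) ^ 2 - ‖z.1‖ ^ 2)

lemma wt_contDiff {ψ : ℝ → ℝ} (hψ : ContDiff ℝ 1 ψ) (c : ℝ) : ContDiff ℝ 1 (wt ψ c) := by
  unfold wt
  exact hψ.comp (((contDiff_const.sub contDiff_snd).pow 2).sub (contDiff_fst.norm_sq ℝ))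

lemma wt_fderiv {ψ : ℝ → ℝ} (hψ : ContDiff ℝ 1 ψ) (c : ℝ) (x : E3) (s : ℝ) (v : E3) (τ : ℝ) :
    fderiv ℝ (wt ψ c) (x, s) (v, τ) =
      deriv ψ ((c - s) ^ 2 - ‖x‖ ^ 2) * (-2 * (c - s) * τ - 2 * inner ℝ x v) := by
  have h1 : HasFDerivAt (fun z : E3 × ℝ => c - z.2) (-(ContinuousLinearMap.snd ℝ E3 ℝ)) (x, s) :=
    hasFDerivAt_snd.const_sub c
  have h2 := (h1.pow 2).sub ((hasFDerivAt_fst (𝕜 := ℝ) (p := (x, s))).norm_sq)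
  have h3 : HasDerivAt ψ (deriv ψ ((c - s) ^ 2 - ‖x‖ ^ 2)) ((c - s) ^ 2 - ‖x‖ ^ 2) :=
    (hψ.differentiable one_ne_zero _).hasDerivAt
  have h4 := h3.comp_hasFDerivAt_of_eq (x, s) h2 (by simp)
  have h5 : fderiv ℝ (wt ψ c) (x, s) = _ := h4.fderiv
  rw [h5]
  simp

lemma dpsi_zero {ψ : ℝ → ℝ} (hm : Monotone ψ) (h0 : ∀ y ≤ 0, ψ y = 0)
    {y : ℝ} (hy : y ≤ 0) : deriv ψ y = 0 := by
  apply IsLocalMin.deriv_eq_zero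
  refine Filter.Eventually.of_forall fun z => ?_
  rw [h0 y hy]
  rcases le_total z 0 with h | h
  · rw [h0 z h]
  · rw [← h0 0 le_rfl]; exact hm h

lemma pointwise (x : E3) (p : Fin 3 → ℝ) (q ρ : ℝ) (h : ‖x‖ ≤ ρ) :
    2 * ∑ i, x i * (p i * q) ≤ ρ * (∑ i, p i ^ 2 + q ^ 2) := by
  have h1 : (∑ i, x i * p i) ^ 2 ≤ ‖x‖ ^ 2 * ∑ i, p i ^ 2 := by
    rw [EuclideanSpace.real_norm_sq_eq]
    exact Finset.sum_mul_sq_le_sq_mul_sq _ _ _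
  have h2 : ∑ i, x i * (p i * q) = (∑ i, x i * p i) * q := by
    rw [Finset.sum_mul]; congr 1; ext i; ring
  rw [h2]
  have hP : 0 ≤ ∑ i, p i ^ 2 := Finset.sum_nonneg fun i _ => sq_nonneg _
  set P := ∑ i, p i ^ 2
  set S := ∑ i, x i * p i
  have hn := norm_nonneg x
  have h3 : |S| ≤ ‖x‖ * √P := by
    apply abs_le_of_sq_le_sq _ (by positivity)
    rw [mul_pow, Real.sq_sqrt hP]; exact h1
  have h4 : S * q ≤ ‖x‖ * √P * |q| := by
    calc S * q ≤ |S * q| := le_abs_self _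
      _ = |S| * |q| := abs_mul _ _
      _ ≤ _ := by gcongr
  have h5 : 2 * (√P * |q|) ≤ P + q ^ 2 := by
    nlinarith [sq_nonneg (√P - |q|), Real.sq_sqrt hP, sq_abs q]
  have h6 : ‖x‖ * (2 * (√P * |q|)) ≤ ρ * (P + q ^ 2) := by
    apply mul_le_mul h h5 (by positivity) (by linarith)
  nlinarith

noncomputable def en (p : Fin 3 → E3 × ℝ → ℝ) (q : E3 × ℝ → ℝ) (z : E3 × ℝ) : ℝ :=
  ∑ i, p i z ^ 2 + q z ^ 2

lemma en_contDiff {p : Fin 3 → E3 × ℝ → ℝ} {q : E3 × ℝ → ℝ}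
    (hp : ∀ i, ContDiff ℝ 1 (p i)) (hq : ContDiff ℝ 1 q) : ContDiff ℝ 1 (en p q) := by
  unfold en
  exact (ContDiff.sum fun i _ => (hp i).pow 2).add (hq.pow 2)

lemma wt_zero {ψ : ℝ → ℝ} (h0 : ∀ y ≤ 0, ψ y = 0) {c s : ℝ} (hs : s ≤ c) {x : E3}
    (hx : c - s ≤ ‖x‖) : wt ψ c (x, s) = 0 := by
  apply h0
  have : (c - s) ^ 2 ≤ ‖x‖ ^ 2 := by
    apply pow_le_pow_left₀ (by linarith) hx
  simpa using this

lemma flux {ψ : ℝ → ℝ} (hψ : ContDiff ℝ 1 ψ) (hm : Monotone ψ) (h0 : ∀ y ≤ 0, ψ y = 0)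
    {p : Fin 3 → E3 × ℝ → ℝ} {q : E3 × ℝ → ℝ}
    (hp : ∀ i, ContDiff ℝ 1 (p i)) (hq : ContDiff ℝ 1 q)
    (hpq : ∀ i z, fderiv ℝ (p i) z (0, 1) = fderiv ℝ q z (EuclideanSpace.single i 1, 0))
    (hqq : ∀ z, fderiv ℝ q z (0, 1) = ∑ i, fderiv ℝ (p i) z (EuclideanSpace.single i 1, 0))
    {c s : ℝ} (hs0 : 0 ≤ s) (hs : s ≤ c) :
    ∫ x in Metric.closedBall (0 : E3) c,
      fderiv ℝ (fun z => wt ψ c z * en p q z) (x, s) (0, 1) ≤ 0 := by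
  have hw := wt_contDiff hψ c
  have he := en_contDiff hp hq
  have sl : ∀ {f : E3 × ℝ → ℝ}, ContDiff ℝ 1 f → ContDiff ℝ 1 (fun y : E3 => f (y, s)) :=
    fun hf => hf.comp (contDiff_id.prodMk contDiff_const)
  have hpqc : ∀ i, ContDiff ℝ 1 (fun z => p i z * q z) := fun i => (hp i).mul hq
  have dzero : ∀ x : E3, c - s ≤ ‖x‖ → deriv ψ ((c - s) ^ 2 - ‖x‖ ^ 2) = 0 := by
    intro x hx
    apply dpsi_zero hm h0
    have : (c - s) ^ 2 ≤ ‖x‖ ^ 2 := pow_le_pow_left₀ (by linarith) hx 2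
    linarith
  have key : ∀ x : E3, fderiv ℝ (fun z => wt ψ c z * en p q z) (x, s) (0, 1) =
      fderiv ℝ (wt ψ c) (x, s) (0, 1) * en p q (x, s) +
      ∑ i, 2 * (wt ψ c (x, s) *
        fderiv ℝ (fun y => p i (y, s) * q (y, s)) x (EuclideanSpace.single i 1)) := by
    intro x
    have e1 : fderiv ℝ (en p q) (x, s) (0, 1) =
        ∑ i, 2 * (p i (x, s) * fderiv ℝ (p i) (x, s) (0, 1)) +
          2 * (q (x, s) * fderiv ℝ q (x, s) (0, 1)) := by
      have a1 : HasFDerivAt (en p q) _ (x, s) :=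
        (HasFDerivAt.fun_sum (u := Finset.univ) fun i _ =>
          (((hp i).differentiable one_ne_zero (x, s)).hasFDerivAt.pow 2)).add
          ((hq.differentiable one_ne_zero (x, s)).hasFDerivAt.pow 2)
      rw [a1.fderiv]
      simp [mul_assoc]
    have e2 := fderiv_fun_mul (hw.differentiable one_ne_zero (x, s))
      (he.differentiable one_ne_zero (x, s))
    rw [e2]
    have e3 : ∀ i, fderiv ℝ (fun y => p i (y, s) * q (y, s)) x (EuclideanSpace.single i 1) =
        p i (x, s) * fderiv ℝ q (x, s) (EuclideanSpace.single i 1, 0) +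
        q (x, s) * fderiv ℝ (p i) (x, s) (EuclideanSpace.single i 1, 0) := by
      intro i
      rw [slice_fderiv (hpqc i), fderiv_fun_mul ((hp i).differentiable one_ne_zero _)
        (hq.differentiable one_ne_zero _)]
      simp
    simp only [e3, add_apply, smul_apply, smul_eq_mul, e1,
      hpq, hqq, Fin.sum_univ_three]
    ring
  have hcs : HasCompactSupport (fun x : E3 => wt ψ c (x, s)) := by
    apply HasCompactSupport.intro (isCompact_closedBall (0 : E3) c)
    intro x hx
    apply wt_zero h0 hs
    simp at hx; linarith
  have hcs' : HasCompactSupport (fun x : E3 => fderiv ℝ (wt ψ c) (x, s) (0, 1)) := by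
    apply HasCompactSupport.intro (isCompact_closedBall (0 : E3) c)
    intro x hx
    simp at hx
    rw [wt_fderiv hψ, dzero x (by linarith), zero_mul]
  rw [setIntegral_eq_integral_of_forall_compl_eq_zero]
  swap
  · intro x hx
    simp at hx
    rw [key, wt_zero h0 hs (by linarith), wt_fderiv hψ, dzero x (by linarith)]
    simp
  simp_rw [key]
  have c1 : Continuous (fun x : E3 => fderiv ℝ (wt ψ c) (x, s) (0, 1) * en p q (x, s)) :=
    (((hw.continuous_fderiv one_ne_zero).comp (by fun_prop)).clm_apply continuous_const).mul
      (sl he).continuous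
  have i1 := c1.integrable_of_hasCompactSupport (μ := volume) hcs'.mul_right
  have i2 : ∀ i, Integrable (fun x : E3 => 2 * (wt ψ c (x, s) *
        fderiv ℝ (fun y => p i (y, s) * q (y, s)) x (EuclideanSpace.single i 1))) := by
    intro i
    apply Integrable.const_mul
    apply Continuous.integrable_of_hasCompactSupport _ hcs.mul_right
    exact (sl hw).continuous.mul
      (((sl (hpqc i)).continuous_fderiv one_ne_zero).clm_apply continuous_const)
  have i3 : ∀ i, Integrable (fun x : E3 => 2 * (
        fderiv ℝ (fun y => wt ψ c (y, s)) x (EuclideanSpace.single i 1)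
          * (p i (x, s) * q (x, s)))) := by
    intro i
    apply Integrable.const_mul
    apply Continuous.integrable_of_hasCompactSupport _
      (hcs.fderiv_apply (𝕜 := ℝ) (EuclideanSpace.single i 1)).mul_right
    exact (((sl hw).continuous_fderiv one_ne_zero).clm_apply continuous_const).mul
      (sl (hpqc i)).continuous
  rw [integral_add i1 (integrable_finsetSum _ fun i _ => i2 i),
    integral_finsetSum _ (fun i _ => i2 i)]
  have e4 : ∀ i, ∫ x : E3, 2 * (wt ψ c (x, s) *
        fderiv ℝ (fun y => p i (y, s) * q (y, s)) x (EuclideanSpace.single i 1)) =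
      - ∫ x : E3, 2 * (fderiv ℝ (fun y => wt ψ c (y, s)) x (EuclideanSpace.single i 1)
          * (p i (x, s) * q (x, s))) := by
    intro i
    rw [integral_const_mul, integral_const_mul, ibp (sl hw) (sl (hpqc i)) hcs]
    ring
  simp_rw [e4]
  rw [Finset.sum_neg_distrib, ← integral_finsetSum _ (fun i _ => i3 i), ← sub_eq_add_neg,
    ← integral_sub i1 (integrable_finsetSum _ fun i _ => i3 i)]
  apply integral_nonpos
  intro x
  simp only [Pi.zero_apply]
  simp_rw [slice_fderiv hw, wt_fderiv hψ]
  have hi : ∀ i : Fin 3, inner ℝ x (EuclideanSpace.single i (1 : ℝ)) = x i := by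
    intro i; simp [EuclideanSpace.inner_single_right]
  simp_rw [hi]
  rcases le_total (c - s) ‖x‖ with h | h
  · rw [dzero x h]; simp
  · have hd : 0 ≤ deriv ψ ((c - s) ^ 2 - ‖x‖ ^ 2) := hm.deriv_nonneg
    have hpt := pointwise x (fun i => p i (x, s)) (q (x, s)) (c - s) h
    have := mul_nonneg hd (sub_nonneg.2 hpt)
    simp only [en, Fin.sum_univ_three, inner_zero_right] at this ⊢
    nlinarith

lemma energy_mono {ψ : ℝ → ℝ} (hψ : ContDiff ℝ 1 ψ) (hm : Monotone ψ) (h0 : ∀ y ≤ 0, ψ y = 0)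
    {p : Fin 3 → E3 × ℝ → ℝ} {q : E3 × ℝ → ℝ}
    (hp : ∀ i, ContDiff ℝ 1 (p i)) (hq : ContDiff ℝ 1 q)
    (hpq : ∀ i z, fderiv ℝ (p i) z (0, 1) = fderiv ℝ q z (EuclideanSpace.single i 1, 0))
    (hqq : ∀ z, fderiv ℝ q z (0, 1) = ∑ i, fderiv ℝ (p i) z (EuclideanSpace.single i 1, 0))
    {c t : ℝ} (ht0 : 0 ≤ t) (ht : t ≤ c) :
    ∫ x in Metric.closedBall (0 : E3) c, wt ψ c (x, t) * en p q (x, t) ≤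
    ∫ x in Metric.closedBall (0 : E3) c, wt ψ c (x, 0) * en p q (x, 0) := by
  have hF : ContDiff ℝ 1 (fun z => wt ψ c z * en p q z) :=
    (wt_contDiff hψ c).mul (en_contDiff hp hq)
  have cF : ∀ s : ℝ, Continuous (fun x : E3 => wt ψ c (x, s) * en p q (x, s)) :=
    fun s => hF.continuous.comp (by fun_prop : Continuous fun x : E3 => (x, s))
  have iF : ∀ s : ℝ, IntegrableOn (fun x : E3 => wt ψ c (x, s) * en p q (x, s))
      (Metric.closedBall (0 : E3) c) :=
    fun s => (cF s).continuousOn.integrableOn_compact (isCompact_closedBall _ _)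
  set F' : E3 × ℝ → ℝ := fun z => fderiv ℝ (fun z => wt ψ c z * en p q z) z (0, 1) with hF'
  have cF' : Continuous F' := (hF.continuous_fderiv one_ne_zero).clm_apply continuous_const
  have ftc : ∀ x : E3, ∫ s in (0:ℝ)..t, F' (x, s) =
      wt ψ c (x, t) * en p q (x, t) - wt ψ c (x, 0) * en p q (x, 0) := by
    intro x
    exact intervalIntegral.integral_eq_sub_of_hasDerivAt (fun s _ => slice_hasDerivAt hF x s)
      ((cF'.comp (by fun_prop : Continuous fun s : ℝ => (x, s))).intervalIntegrable _ _)
  rw [← sub_nonpos, ← integral_sub (iF t) (iF 0)]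
  simp_rw [← ftc, intervalIntegral.integral_of_le ht0]
  rw [integral_integral_swap]
  · apply setIntegral_nonpos measurableSet_Ioc
    intro s hs
    exact flux hψ hm h0 hp hq hpq hqq hs.1.le (hs.2.trans ht)
  · rw [Measure.prod_restrict]
    have : IntegrableOn F' (Metric.closedBall (0 : E3) c ×ˢ Set.Icc 0 t) :=
      cF'.continuousOn.integrableOn_compact ((isCompact_closedBall _ _).prod isCompact_Icc)
    exact this.mono_set (Set.prod_mono_right Set.Ioc_subset_Icc_self)

lemma energy_ball {p : Fin 3 → E3 × ℝ → ℝ} {q : E3 × ℝ → ℝ}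
    (hp : ∀ i, ContDiff ℝ 1 (p i)) (hq : ContDiff ℝ 1 q)
    (hpq : ∀ i z, fderiv ℝ (p i) z (0, 1) = fderiv ℝ q z (EuclideanSpace.single i 1, 0))
    (hqq : ∀ z, fderiv ℝ q z (0, 1) = ∑ i, fderiv ℝ (p i) z (EuclideanSpace.single i 1, 0))
    {R r t : ℝ} (ht0 : 0 ≤ t) (hr : 0 ≤ r) (hrR : r < R) :
    ∫ x in Metric.ball (0 : E3) r, en p q (x, t) ≤
    ∫ x in Metric.ball (0 : E3) (R + t), en p q (x, 0) := by
  set η := R ^ 2 - r ^ 2 with hη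
  have hη0 : 0 < η := by rw [hη]; nlinarith
  set ψ : ℝ → ℝ := fun y => Real.smoothTransition (y / η)
  have hψ : ContDiff ℝ 1 ψ := Real.smoothTransition.contDiff.comp (contDiff_id.div_const η)
  have hm : Monotone ψ := fun a b h => Real.smoothTransition.monotone (by gcongr)
  have h0 : ∀ y ≤ 0, ψ y = 0 := fun y hy =>
    Real.smoothTransition.zero_of_nonpos (div_nonpos_of_nonpos_of_nonneg hy hη0.le)
  have hn : ∀ y, 0 ≤ ψ y := fun y => Real.smoothTransition.nonneg _
  have h1 : ∀ y, ψ y ≤ 1 := fun y => Real.smoothTransition.le_one _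
  have main := energy_mono hψ hm h0 hp hq hpq hqq (c := R + t) ht0 (by linarith)
  have he := (en_contDiff hp hq).continuous
  have hw := (wt_contDiff hψ (R + t)).continuous
  have een : ∀ z, 0 ≤ en p q z := fun z => by unfold en; positivity
  have ce : ∀ s : ℝ, Continuous (fun x : E3 => en p q (x, s)) := fun s => by fun_prop
  have cw : ∀ s : ℝ, Continuous (fun x : E3 => wt ψ (R + t) (x, s)) := fun s => by fun_prop
  have ie : ∀ s a : ℝ, IntegrableOn (fun x : E3 => en p q (x, s)) (Metric.closedBall (0 : E3) a) :=
    fun s a => (ce s).continuousOn.integrableOn_compact (isCompact_closedBall _ _)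
  have iw : ∀ s a : ℝ, IntegrableOn (fun x : E3 => wt ψ (R + t) (x, s) * en p q (x, s))
      (Metric.closedBall (0 : E3) a) :=
    fun s a => ((cw s).mul (ce s)).continuousOn.integrableOn_compact (isCompact_closedBall _ _)
  calc ∫ x in Metric.ball (0 : E3) r, en p q (x, t)
      = ∫ x in Metric.ball (0 : E3) r, wt ψ (R + t) (x, t) * en p q (x, t) := by
        apply setIntegral_congr_fun measurableSet_ball
        intro x hx
        have hx' : ‖x‖ < r := by simpa using hx
        have : wt ψ (R + t) (x, t) = 1 := by
          apply Real.smoothTransition.one_of_one_le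
          rw [le_div_iff₀ hη0]
          simp only [hη]
          nlinarith [norm_nonneg x]
        simp [this]
    _ ≤ ∫ x in Metric.closedBall (0 : E3) (R + t), wt ψ (R + t) (x, t) * en p q (x, t) := by
        apply setIntegral_mono_set (iw _ _)
        · exact Filter.Eventually.of_forall fun x => mul_nonneg (hn _) (een _)
        · exact (Metric.ball_subset_closedBall.trans
            (Metric.closedBall_subset_closedBall (by linarith))).eventuallyLE
    _ ≤ _ := main
    _ ≤ ∫ x in Metric.closedBall (0 : E3) (R + t), en p q (x, 0) := by
        apply integral_mono (iw _ _) (ie _ _)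
        intro x
        exact mul_le_of_le_one_left (een _) (h1 _)
    _ = _ := by
        apply setIntegral_congr_set
        refine (ae_eq_of_subset_of_measure_ge Metric.ball_subset_closedBall ?_
          measurableSet_ball.nullMeasurableSet measure_closedBall_lt_top.ne).symm
        rw [Measure.addHaar_closedBall_eq_addHaar_ball]

lemma energy_ball' {p : Fin 3 → E3 × ℝ → ℝ} {q : E3 × ℝ → ℝ}
    (hp : ∀ i, ContDiff ℝ 1 (p i)) (hq : ContDiff ℝ 1 q)
    (hpq : ∀ i z, fderiv ℝ (p i) z (0, 1) = fderiv ℝ q z (EuclideanSpace.single i 1, 0))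
    (hqq : ∀ z, fderiv ℝ q z (0, 1) = ∑ i, fderiv ℝ (p i) z (EuclideanSpace.single i 1, 0))
    {R t : ℝ} (ht0 : 0 ≤ t) (hR : 0 < R) :
    ∫ x in Metric.ball (0 : E3) R, en p q (x, t) ≤
    ∫ x in Metric.ball (0 : E3) (R + t), en p q (x, 0) := by
  have he := (en_contDiff hp hq).continuous
  have ce : ∀ s : ℝ, Continuous (fun x : E3 => en p q (x, s)) := fun s => by fun_prop
  have ie : IntegrableOn (fun x : E3 => en p q (x, t)) (Metric.ball (0 : E3) R) :=
    ((ce t).continuousOn.integrableOn_compact (isCompact_closedBall _ _)).mono_set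
      Metric.ball_subset_closedBall
  obtain ⟨r, hrm, hrl, hrt⟩ := exists_seq_strictMono_tendsto' hR
  have hU : ⋃ n, Metric.ball (0 : E3) (r n) = Metric.ball 0 R := by
    ext x
    simp only [Set.mem_iUnion, mem_ball_zero_iff]
    constructor
    · rintro ⟨n, hn⟩; exact hn.trans (hrl n).2
    · intro hx
      exact (hrt.eventually (lt_mem_nhds hx)).exists
  have ht := tendsto_setIntegral_of_monotone (μ := volume)
    (f := fun x : E3 => en p q (x, t)) (s := fun n => Metric.ball (0 : E3) (r n))
    (fun n => measurableSet_ball) (fun a b h => Metric.ball_subset_ball (hrm.monotone h))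
    (by rw [hU]; exact ie)
  rw [hU] at ht
  exact le_of_tendsto' ht fun n => energy_ball hp hq hpq hqq ht0 (hrl n).1.le (hrl n).2

lemma energy_pos
    (u : E3 × ℝ → ℝ) (hu : ContDiff ℝ 2 u)
    (hwave : ∀ (x : E3) (t : ℝ),
      deriv (fun s => deriv (fun s' => u (x, s')) s) t =
        ∑ i : Fin 3,
          fderiv ℝ (fderiv ℝ (fun y => u (y, t))) x
            (EuclideanSpace.single i 1) (EuclideanSpace.single i 1))
    (R : ℝ) (hR : 0 < R) (t : ℝ) (ht : 0 ≤ t) :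
    (∫ x in Metric.ball (0 : E3) R,
        (‖gradient (fun y => u (y, t)) x‖ ^ 2 + (deriv (fun s => u (x, s)) t) ^ 2)) ≤
      ∫ x in Metric.ball (0 : E3) (R + t),
        (‖gradient (fun y => u (y, 0)) x‖ ^ 2 + (deriv (fun s => u (x, s)) 0) ^ 2) := by
  have hu1 : ContDiff ℝ 1 u := hu.of_le (by norm_num)
  have hD : ContDiff ℝ 1 (fderiv ℝ u) := hu.fderiv_right (by norm_num)
  set p : Fin 3 → E3 × ℝ → ℝ := fun i z => fderiv ℝ u z (EuclideanSpace.single i 1, 0) with hpd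
  set q : E3 × ℝ → ℝ := fun z => fderiv ℝ u z (0, 1) with hqd
  have hp : ∀ i, ContDiff ℝ 1 (p i) := fun i => hD.clm_apply contDiff_const
  have hq : ContDiff ℝ 1 q := hD.clm_apply contDiff_const
  have d2 : ∀ z v w, fderiv ℝ (fun z => fderiv ℝ u z v) z w = fderiv ℝ (fderiv ℝ u) z w v := by
    intro z v w
    rw [fderiv_clm_apply (hD.differentiable one_ne_zero z) (differentiableAt_const v)]
    simp
  have hsymm : ∀ z v w, fderiv ℝ (fderiv ℝ u) z v w = fderiv ℝ (fderiv ℝ u) z w v := by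
    intro z v w
    exact (hu.contDiffAt.isSymmSndFDerivAt (by simp)) v w
  have hdt : ∀ x s, deriv (fun s' => u (x, s')) s = q (x, s) := fun x s =>
    (slice_hasDerivAt hu1 x s).deriv
  have hen : ∀ x s, ‖gradient (fun y => u (y, s)) x‖ ^ 2 + (deriv (fun s' => u (x, s')) s) ^ 2
      = en p q (x, s) := by
    intro x s
    rw [hdt, en, EuclideanSpace.real_norm_sq_eq]
    congr 1
    apply Finset.sum_congr rfl
    intro i _
    congr 1
    rw [hpd]
    simp only
    rw [← slice_fderiv hu1]
    have : inner ℝ (gradient (fun y => u (y, s)) x) (EuclideanSpace.single i (1 : ℝ)) =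
      fderiv ℝ (fun y => u (y, s)) x (EuclideanSpace.single i 1) := by
      rw [gradient, InnerProductSpace.toDual_symm_apply]
    refine Eq.trans ?_ this
    rw [EuclideanSpace.inner_single_right]
    simp
  simp_rw [hen]
  apply energy_ball' hp hq _ _ ht hR
  · intro i z
    rw [d2, d2, hsymm]
  · rintro ⟨x, s⟩
    have := hwave x s
    simp_rw [hdt] at this
    rw [(slice_hasDerivAt hq x s).deriv] at this
    rw [this]
    apply Finset.sum_congr rfl
    intro i _
    have hus : ContDiff ℝ 2 (fun y : E3 => u (y, s)) := hu.comp (contDiff_id.prodMk contDiff_const)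
    have hds : DifferentiableAt ℝ (fderiv ℝ (fun y : E3 => u (y, s))) x :=
      (hus.fderiv_right (m := 1) (by norm_num)).differentiable one_ne_zero x
    have e1 : fderiv ℝ (fun y => fderiv ℝ (fun y : E3 => u (y, s)) y (EuclideanSpace.single i 1)) x
        (EuclideanSpace.single i 1) = fderiv ℝ (fderiv ℝ (fun y => u (y, s))) x
            (EuclideanSpace.single i 1) (EuclideanSpace.single i 1) := by
      rw [fderiv_clm_apply hds (differentiableAt_const _)]
      simp
    rw [← e1]
    simp_rw [slice_fderiv hu1]
    exact slice_fderiv (hp i) _ _ _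


open MeasureTheory

/-- Energy inequality (finite speed of propagation) for the wave equation in `ℝ³`:
if `∂²u/∂t² = Δₓ u`, then the local energy on the ball of radius `R` at time `t` is bounded
by the energy on the ball of radius `R + |t|` at time `0`. -/
theorem wave_equation_energy_inequality
    (u : EuclideanSpace ℝ (Fin 3) × ℝ → ℝ) (hu : ContDiff ℝ 2 u)
    (hwave : ∀ (x : EuclideanSpace ℝ (Fin 3)) (t : ℝ),
      deriv (fun s => deriv (fun s' => u (x, s')) s) t =
        ∑ i : Fin 3,
          fderiv ℝ (fderiv ℝ (fun y => u (y, t))) x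
            (EuclideanSpace.single i 1) (EuclideanSpace.single i 1))
    (R : ℝ) (hR : 0 < R) (t : ℝ) :
    (∫ x in Metric.ball (0 : EuclideanSpace ℝ (Fin 3)) R,
        (‖gradient (fun y => u (y, t)) x‖ ^ 2 + (deriv (fun s => u (x, s)) t) ^ 2)) ≤
      ∫ x in Metric.ball (0 : EuclideanSpace ℝ (Fin 3)) (R + |t|),
        (‖gradient (fun y => u (y, 0)) x‖ ^ 2 + (deriv (fun s => u (x, s)) 0) ^ 2) := by
  rcases le_total 0 t with ht | ht
  · rw [abs_of_nonneg ht]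
    exact energy_pos u hu hwave R hR t ht
  · rw [abs_of_nonpos ht]
    have hn : ContDiff ℝ 2 (fun z : E3 × ℝ => u (z.1, -z.2)) :=
      hu.comp (contDiff_fst.prodMk contDiff_snd.neg)
    have hd : ∀ (x : E3) (s : ℝ), deriv (fun s' => u (x, -s')) s =
        - deriv (fun s' => u (x, s')) (-s) := fun x s =>
      deriv_comp_neg (fun s' => u (x, s')) s
    have := energy_pos (fun z : E3 × ℝ => u (z.1, -z.2)) hn (by
      intro x s
      rw [← hwave x (-s)]
      simp_rw [hd]
      rw [deriv.fun_neg, deriv_comp_neg (fun s => deriv (fun s' => u (x, s')) s), neg_neg])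
      R hR (-t) (by linarith)
    simpa only [hd, neg_neg, neg_zero, neg_sq] using this
end

section
/- Let ν : [0,∞) → [0,∞) be continuous, nonincreasing, with ∫₀^∞ r ν(r) dr < ∞. Let a > 0, let q₋, q₊ : ℝ³ → ℝ be continuous with |q_±(z)| ≤ ν(|z|) for all z, and let Q : ℝ³ × ℝ³ → ℝ be continuous with |Q(x,y)| ≤ ν(|x − y|) for all x, y, such that Q(x,y) = q₋(x − y) whenever x₃ < −a and y₃ < −a, and Q(x,y) = q₊(x − y) whenever x₃ > a and y₃ > a. Then for all x, y ∈ ℝ³: lim_{t→∞} (1/(4π)²) ∫_{{ω : |ω| = 1, ω₃ < 0}} [ ∫_{S_t(y)} Q(x + tω, y') dH²(y') ] dS(ω) = (1/(4π)²) ∫_{{ω : |ω| = 1, ω₃ < 0}} [ ∫_{{p ∈ ℝ³ : ⟨p, ω⟩ = ⟨x − y, ω⟩}} q₋(p) dH²(p) ] dS(ω), and the analogous limit holds with the half-sphere ω₃ > 0 and q₊ in place of ω₃ < 0 and q₋. -/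
open MeasureTheory Filter
open scoped ENNReal RealInnerProductSpace

namespace CSI

abbrev E3 := EuclideanSpace ℝ (Fin 3)
abbrev V2 := EuclideanSpace ℝ (Fin 2)

instance haarV2 : (μH[2] : Measure V2).IsAddHaarMeasure := by
  have h := MeasureTheory.isAddHaarMeasure_hausdorffMeasure (E := V2)
  simpa using h

/-- a linear isometric parametrisation of the orthogonal plane -/
lemma exists_L (ω : E3) (hω : ‖ω‖ = 1) :
    ∃ L : V2 →ₗᵢ[ℝ] E3, ∀ p : E3, ⟪p, ω⟫ = 0 ↔ p ∈ Set.range L := by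
  have : Fact (Module.finrank ℝ E3 = 2 + 1) := ⟨by simp⟩
  have h0 : ω ≠ 0 := by intro h; simp [h] at hω
  let b := OrthonormalBasis.fromOrthogonalSpanSingleton (𝕜 := ℝ) (E := E3) 2 h0
  refine ⟨(Submodule.subtypeₗᵢ _).comp b.repr.symm.toLinearIsometry, fun p => ?_⟩
  rw [← Submodule.mem_orthogonal_singleton_iff_inner_left]
  constructor
  · intro hp
    exact ⟨b.repr ⟨p, hp⟩, by simp⟩
  · rintro ⟨v, rfl⟩
    simp

/-- inverse stereographic projection -/
noncomputable def sg (y ω : E3) (L : V2 →ₗᵢ[ℝ] E3) (t : ℝ) (v : V2) : E3 :=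
  EuclideanGeometry.inversion (y - t • ω) (2 * t) ((y - t • ω) + ((2 * t) • ω - L v))

section
variable {y ω : E3} {L : V2 →ₗᵢ[ℝ] E3} {t : ℝ}

lemma normsq (hω : ‖ω‖ = 1) (hL : ∀ p : E3, ⟪p, ω⟫ = 0 ↔ p ∈ Set.range L) (v : V2) :
    ‖(2 * t) • ω - L v‖ ^ 2 = 4 * t ^ 2 + ‖v‖ ^ 2 := by
  have h : ⟪L v, ω⟫ = 0 := (hL _).2 ⟨v, rfl⟩
  rw [norm_sub_sq_real, inner_smul_left, real_inner_comm, h, norm_smul, hω, L.norm_map,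
    mul_pow, Real.norm_eq_abs, sq_abs]
  simp; ring

lemma sg_formula (hω : ‖ω‖ = 1) (hL : ∀ p : E3, ⟪p, ω⟫ = 0 ↔ p ∈ Set.range L) (v : V2) :
    sg y ω L t v = (4 * t ^ 2 / (4 * t ^ 2 + ‖v‖ ^ 2)) • ((2 * t) • ω - L v) + (y - t • ω) := by
  rw [sg, EuclideanGeometry.inversion_def]
  simp only [vsub_eq_sub, vadd_eq_add, dist_eq_norm, add_sub_cancel_left]
  rw [div_pow, normsq hω hL, mul_pow]; norm_num

lemma dist_sg (ht : 0 < t) (hω : ‖ω‖ = 1) (hL : ∀ p : E3, ⟪p, ω⟫ = 0 ↔ p ∈ Set.range L)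
    (u v : V2) : dist (sg y ω L t u) (sg y ω L t v) =
      4 * t ^ 2 / (√(4 * t ^ 2 + ‖u‖ ^ 2) * √(4 * t ^ 2 + ‖v‖ ^ 2)) * dist u v := by
  have hn : ∀ v : V2, ‖(2 * t) • ω - L v‖ = √(4 * t ^ 2 + ‖v‖ ^ 2) := fun v => by
    rw [← normsq hω hL, Real.sqrt_sq (norm_nonneg _)]
  have hne : ∀ v : V2, (y - t • ω) + ((2 * t) • ω - L v) ≠ y - t • ω := fun v h => by
    have h2 : (2 * t) • ω - L v = 0 := by simpa using h
    have := normsq (t := t) hω hL v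
    rw [h2] at this
    simp at this
    nlinarith [sq_nonneg ‖v‖, sq_pos_of_pos ht]
  rw [sg, sg, EuclideanGeometry.dist_inversion_inversion (hne u) (hne v)]
  simp only [dist_eq_norm, add_sub_cancel_left, hn]
  have : y - t • ω + ((2 * t) • ω - L u) - (y - t • ω + ((2 * t) • ω - L v)) = L (v - u) := by
    rw [map_sub]; abel
  rw [this, L.norm_map, norm_sub_rev v u]; ring

lemma sqrt_ge (ht : 0 < t) (v : V2) : 2 * t ≤ √(4 * t ^ 2 + ‖v‖ ^ 2) := by
  apply Real.le_sqrt_of_sq_le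
  nlinarith [sq_nonneg ‖v‖]

lemma dist_sg_le (ht : 0 < t) (hω : ‖ω‖ = 1) (hL : ∀ p : E3, ⟪p, ω⟫ = 0 ↔ p ∈ Set.range L)
    (u v : V2) : dist (sg y ω L t u) (sg y ω L t v) ≤ dist u v := by
  rw [dist_sg ht hω hL]
  have h1 := sqrt_ge ht u
  have h2 := sqrt_ge ht v
  apply mul_le_of_le_one_left dist_nonneg
  rw [div_le_one (by nlinarith)]
  nlinarith

lemma le_dist_sg (ht : 0 < t) (hω : ‖ω‖ = 1) (hL : ∀ p : E3, ⟪p, ω⟫ = 0 ↔ p ∈ Set.range L)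
    {u v : V2} (hu : ‖u‖ ^ 2 ≤ t) (hv : ‖v‖ ^ 2 ≤ t) :
    dist u v ≤ (1 + 1 / (4 * t)) * dist (sg y ω L t u) (sg y ω L t v) := by
  rw [dist_sg ht hω hL, ← mul_assoc]
  have h1 := sqrt_ge ht u
  have h2 := sqrt_ge ht v
  apply le_mul_of_one_le_left dist_nonneg
  have h3 : √(4 * t ^ 2 + ‖u‖ ^ 2) * √(4 * t ^ 2 + ‖v‖ ^ 2) ≤ 4 * t ^ 2 + t := by
    rw [← Real.sqrt_mul (by positivity)]
    apply Real.sqrt_le_iff.2 ⟨by positivity, ?_⟩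
    rw [sq (4 * t ^ 2 + t)]
    exact mul_le_mul (by linarith) (by linarith) (by positivity) (by positivity)
  rw [mul_div_assoc', one_le_div (by nlinarith)]
  have : (1 + 1 / (4 * t)) * (4 * t ^ 2) = 4 * t ^ 2 + t := by field_simp
  rw [this]; exact h3

lemma sg_zero (ht : 0 < t) (hω : ‖ω‖ = 1) (hL : ∀ p : E3, ⟪p, ω⟫ = 0 ↔ p ∈ Set.range L) :
    sg y ω L t 0 = y + t • ω := by
  rw [sg_formula hω hL]
  have : 4 * t ^ 2 / (4 * t ^ 2 + ‖(0:V2)‖ ^ 2) = 1 := by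
    rw [norm_zero, zero_pow two_ne_zero, add_zero]
    exact div_self (by positivity)
  rw [this]; simp; module

lemma dist_sg_zero (ht : 0 < t) (hω : ‖ω‖ = 1) (hL : ∀ p : E3, ⟪p, ω⟫ = 0 ↔ p ∈ Set.range L)
    (v : V2) : dist (sg y ω L t v) (y + t • ω) = 2 * t * ‖v‖ / √(4 * t ^ 2 + ‖v‖ ^ 2) := by
  rw [← sg_zero ht hω hL, dist_sg ht hω hL]
  have : √(4 * t ^ 2 + ‖(0:V2)‖ ^ 2) = 2 * t := by
    rw [show 4 * t ^ 2 + ‖(0:V2)‖ ^ 2 = (2 * t) ^ 2 by simp; ring]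
    exact Real.sqrt_sq (by positivity)
  rw [this]
  have := sqrt_ge ht v
  have : 0 < √(4 * t ^ 2 + ‖v‖ ^ 2) := by linarith
  simp
  field_simp
  ring

lemma near (ht : 0 < t) (hω : ‖ω‖ = 1) (hL : ∀ p : E3, ⟪p, ω⟫ = 0 ↔ p ∈ Set.range L)
    {v : V2} (hv : ‖v‖ ≤ 2 * t) : ‖v‖ / 2 ≤ dist (sg y ω L t v) (y + t • ω) := by
  rw [dist_sg_zero ht hω hL]
  have h1 := sqrt_ge ht v
  have h2 : √(4 * t ^ 2 + ‖v‖ ^ 2) ≤ 4 * t := by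
    apply Real.sqrt_le_iff.2 ⟨by positivity, ?_⟩
    nlinarith [norm_nonneg v]
  rw [le_div_iff₀ (by linarith)]
  nlinarith [norm_nonneg v]

lemma far (ht : 0 < t) (hω : ‖ω‖ = 1) (hL : ∀ p : E3, ⟪p, ω⟫ = 0 ↔ p ∈ Set.range L)
    {v : V2} (hv : 2 * t ≤ ‖v‖) : t ≤ dist (sg y ω L t v) (y + t • ω) := by
  rw [dist_sg_zero ht hω hL]
  have h1 := sqrt_ge ht v
  have h2 : √(4 * t ^ 2 + ‖v‖ ^ 2) ≤ 2 * ‖v‖ := by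
    apply Real.sqrt_le_iff.2 ⟨by positivity, ?_⟩
    nlinarith [norm_nonneg v]
  rw [le_div_iff₀ (by linarith)]
  nlinarith [norm_nonneg v]

lemma sg_lip (ht : 0 < t) (hω : ‖ω‖ = 1) (hL : ∀ p : E3, ⟪p, ω⟫ = 0 ↔ p ∈ Set.range L) :
    LipschitzWith 1 (sg y ω L t) :=
  LipschitzWith.of_dist_le_mul fun u v => by simpa using dist_sg_le ht hω hL u v

lemma sg_inj (ht : 0 < t) : Function.Injective (sg y ω L t) := by
  intro u v h
  have := EuclideanGeometry.inversion_injective _ (by positivity : 2 * t ≠ 0) h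
  simpa using this

lemma sg_emb (ht : 0 < t) (hω : ‖ω‖ = 1) (hL : ∀ p : E3, ⟪p, ω⟫ = 0 ↔ p ∈ Set.range L) :
    MeasurableEmbedding (sg y ω L t) :=
  (sg_lip ht hω hL).continuous.measurableEmbedding (sg_inj ht)

lemma sg_surj (ht : 0 < t) (hω : ‖ω‖ = 1) (hL : ∀ p : E3, ⟪p, ω⟫ = 0 ↔ p ∈ Set.range L)
    {z : E3} (hz : z ∈ Metric.sphere y t) (hzN : z ≠ y - t • ω) :
    ∃ v, sg y ω L t v = z ∧ ‖z - (y - t • ω)‖ ^ 2 * (4 * t ^ 2 + ‖v‖ ^ 2) = 16 * t ^ 4 := by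
  set w := z - (y - t • ω) with hw
  have hw0 : w ≠ 0 := sub_ne_zero.2 hzN
  have hwn : 0 < ‖w‖ := norm_pos_iff.2 hw0
  have hin : ‖w‖ ^ 2 = 2 * t * ⟪w, ω⟫ := by
    have h1 : ‖w - t • ω‖ = t := by
      have : w - t • ω = z - y := by rw [hw]; abel
      rw [this]; simpa [dist_eq_norm] using hz
    have h2 := norm_sub_sq_real w (t • ω)
    rw [h1, inner_smul_right, norm_smul, hω, Real.norm_eq_abs, mul_one, sq_abs] at h2
    linarith
  have horth : ⟪(2 * t) • ω - (4 * t ^ 2 / ‖w‖ ^ 2) • w, ω⟫ = 0 := by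
    rw [inner_sub_left, inner_smul_left, inner_smul_left, real_inner_self_eq_norm_sq, hω]
    simp only [conj_trivial]
    have : ⟪w, ω⟫ = ‖w‖ ^ 2 / (2 * t) := by rw [hin]; field_simp
    rw [this]; field_simp; ring
  obtain ⟨v, hv⟩ := (hL _).1 horth
  have hns := normsq (t := t) hω hL v
  rw [hv, sub_sub_cancel, norm_smul, mul_pow, Real.norm_eq_abs, sq_abs] at hns
  have hk : 4 * t ^ 2 + ‖v‖ ^ 2 = 16 * t ^ 4 / ‖w‖ ^ 2 := by
    rw [← hns]; field_simp; norm_num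
  refine ⟨v, ?_, ?_⟩
  · rw [sg_formula hω hL, hv, sub_sub_cancel, hk, smul_smul]
    have : 4 * t ^ 2 / (16 * t ^ 4 / ‖w‖ ^ 2) * (4 * t ^ 2 / ‖w‖ ^ 2) = 1 := by
      field_simp; norm_num
    rw [this, one_smul, hw]; abel
  · rw [hk]; field_simp

lemma sg_mem (ht : 0 < t) (hω : ‖ω‖ = 1) (hL : ∀ p : E3, ⟪p, ω⟫ = 0 ↔ p ∈ Set.range L)
    (v : V2) : sg y ω L t v ∈ Metric.sphere y t := by
  have h : ⟪L v, ω⟫ = 0 := (hL _).2 ⟨v, rfl⟩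
  have hp : 0 < 4 * t ^ 2 + ‖v‖ ^ 2 := by positivity
  set k := 4 * t ^ 2 / (4 * t ^ 2 + ‖v‖ ^ 2) with hk
  have h1 : sg y ω L t v - y = k • ((2 * t) • ω - L v) - t • ω := by
    rw [sg_formula hω hL]; abel
  have h2 : ‖sg y ω L t v - y‖ ^ 2 = t ^ 2 := by
    rw [h1, norm_sub_sq_real, norm_smul, mul_pow, normsq hω hL, norm_smul, hω, inner_smul_left,
      inner_smul_right, inner_sub_left, h, inner_smul_left, real_inner_self_eq_norm_sq, hω]
    simp only [Real.norm_eq_abs, sq_abs, mul_one, conj_trivial]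
    rw [hk]; field_simp; ring
  rw [mem_sphere_iff_norm]
  exact (pow_left_inj₀ (norm_nonneg _) ht.le two_ne_zero).1 h2

lemma range_sg_ae (ht : 0 < t) (hω : ‖ω‖ = 1) (hL : ∀ p : E3, ⟪p, ω⟫ = 0 ↔ p ∈ Set.range L) :
    (μH[2] : Measure E3).restrict (Metric.sphere y t)
      = (μH[2] : Measure E3).restrict (Set.range (sg y ω L t)) := by
  have := Measure.nullSingletonClass_hausdorff E3 (d := 2) two_pos
  apply Measure.restrict_congr_set
  have h0 : ∀ᵐ z ∂(μH[2] : Measure E3), z ≠ y - t • ω := by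
    simp [ae_iff]
  filter_upwards [h0] with z hz
  apply propext
  constructor
  · intro h
    obtain ⟨v, hv, -⟩ := sg_surj ht hω hL h hz
    exact ⟨v, hv⟩
  · rintro ⟨v, rfl⟩
    exact sg_mem ht hω hL v

/-- the pulled back surface measure -/
noncomputable def mt (y ω : E3) (L : V2 →ₗᵢ[ℝ] E3) (t : ℝ) : Measure V2 :=
  Measure.comap (sg y ω L t) μH[2]

lemma integral_mt (ht : 0 < t) (hω : ‖ω‖ = 1) (hL : ∀ p : E3, ⟪p, ω⟫ = 0 ↔ p ∈ Set.range L)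
    (F : E3 → ℝ) : ∫ z in Metric.sphere y t, F z ∂(μH[2]) = ∫ v, F (sg y ω L t v) ∂(mt y ω L t) := by
  rw [range_sg_ae ht hω hL, ← (sg_emb ht hω hL).map_comap, (sg_emb ht hω hL).integral_map, mt]

lemma mt_le (ht : 0 < t) (hω : ‖ω‖ = 1) (hL : ∀ p : E3, ⟪p, ω⟫ = 0 ↔ p ∈ Set.range L) :
    mt y ω L t ≤ μH[2] := by
  refine Measure.le_iff.2 fun s _ => ?_
  rw [mt, (sg_emb ht hω hL).comap_apply]
  simpa using (sg_lip ht hω hL).hausdorffMeasure_image_le (d := 2) (by norm_num) s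

lemma mt_ge (ht : 0 < t) (hω : ‖ω‖ = 1) (hL : ∀ p : E3, ⟪p, ω⟫ = 0 ↔ p ∈ Set.range L) :
    (μH[2] : Measure V2).restrict {v | ‖v‖ ^ 2 ≤ t} ≤
      ENNReal.ofReal ((1 + 1 / (4 * t)) ^ 2) • (mt y ω L t).restrict {v | ‖v‖ ^ 2 ≤ t} := by
  have hB : MeasurableSet {v : V2 | ‖v‖ ^ 2 ≤ t} := measurableSet_le (by fun_prop) (by fun_prop)
  refine Measure.le_iff.2 fun s hs => ?_
  rw [Measure.smul_apply, Measure.restrict_apply hs, Measure.restrict_apply hs, mt,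
    (sg_emb ht hω hL).comap_apply]
  set A := s ∩ {v : V2 | ‖v‖ ^ 2 ≤ t}
  set τ := Function.invFun (sg y ω L t)
  have hτ : ∀ v, τ (sg y ω L t v) = v := Function.leftInverse_invFun (sg_inj ht)
  have hl : LipschitzOnWith (1 + 1 / (4 * t)).toNNReal τ (sg y ω L t '' A) := by
    refine LipschitzOnWith.of_dist_le_mul ?_
    rintro _ ⟨u, hu, rfl⟩ _ ⟨v, hv, rfl⟩
    rw [hτ, hτ, Real.coe_toNNReal _ (by positivity)]
    exact le_dist_sg ht hω hL hu.2 hv.2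
  have := hl.hausdorffMeasure_image_le (d := 2) (by norm_num)
  rw [Set.image_image] at this
  simp only [hτ, Set.image_id'] at this
  refine this.trans (le_of_eq ?_)
  rw [smul_eq_mul, ENNReal.ofReal_pow (by positivity)]
  norm_cast

lemma sphere_le (ht : 0 < t) (hω : ‖ω‖ = 1) (hL : ∀ p : E3, ⟪p, ω⟫ = 0 ↔ p ∈ Set.range L) :
    μH[2] (Metric.sphere y t) ≤
      ENNReal.ofReal (8 * t ^ 2) * μH[2] (Metric.closedBall (0 : V2) 1) := by
  have hω' : ‖-ω‖ = 1 := by simpa using hω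
  have hL' : ∀ p : E3, ⟪p, -ω⟫ = 0 ↔ p ∈ Set.range L := fun p => by
    rw [inner_neg_right, neg_eq_zero, hL]
  set D := Metric.closedBall (0 : V2) (2 * t)
  have key : ∀ ω : E3, ‖ω‖ = 1 → (∀ p : E3, ⟪p, ω⟫ = 0 ↔ p ∈ Set.range L) →
      ∀ z ∈ Metric.sphere y t, 0 ≤ ⟪z - y, ω⟫ → z ∈ sg y ω L t '' D := by
    intro ω hω hL z hz h
    have hn : ‖z - y‖ = t := by simpa [dist_eq_norm] using hz
    have h2 : 2 * t ^ 2 ≤ ‖z - (y - t • ω)‖ ^ 2 := by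
      rw [show z - (y - t • ω) = (z - y) + t • ω by abel, norm_add_sq_real, hn, norm_smul, hω,
        inner_smul_right, Real.norm_eq_abs, mul_one, sq_abs]
      nlinarith
    have hzN : z ≠ y - t • ω := by
      rintro rfl
      simp at h2
      nlinarith
    obtain ⟨v, hv, h3⟩ := sg_surj ht hω hL hz hzN
    refine ⟨v, ?_, hv⟩
    rw [mem_closedBall_zero_iff]
    apply (pow_le_pow_iff_left₀ (norm_nonneg _) (by positivity) two_ne_zero).1
    by_contra hc
    push Not at hc
    nlinarith [sq_pos_of_pos ht]
  have hsub : Metric.sphere y t ⊆ sg y ω L t '' D ∪ sg y (-ω) L t '' D := by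
    intro z hz
    rcases le_total 0 ⟪z - y, ω⟫ with h | h
    · exact Or.inl (key ω hω hL z hz h)
    · exact Or.inr (key (-ω) hω' hL' z hz (by rw [inner_neg_right]; linarith))
  have hD : μH[2] D = ENNReal.ofReal (4 * t ^ 2) * μH[2] (Metric.closedBall (0 : V2) 1) := by
    have := Measure.addHaar_closedBall' (μH[2] : Measure V2) 0 (r := 2 * t) (by positivity)
    rw [this, finrank_euclideanSpace_fin]; ring_nf
  have h1 := (sg_lip (y := y) ht hω hL).hausdorffMeasure_image_le (d := 2) (by norm_num) D
  have h2 := (sg_lip (y := y) ht hω' hL').hausdorffMeasure_image_le (d := 2) (by norm_num) D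
  simp only [ENNReal.coe_one, ENNReal.one_rpow, one_mul] at h1 h2
  calc _ ≤ _ := measure_mono hsub
    _ ≤ _ := measure_union_le _ _
    _ ≤ μH[2] D + μH[2] D := add_le_add h1 h2
    _ = _ := by
      rw [hD, ← add_mul, ← ENNReal.ofReal_add (by positivity) (by positivity)]
      ring_nf

lemma mt_univ_le (ht : 0 < t) (hω : ‖ω‖ = 1) (hL : ∀ p : E3, ⟪p, ω⟫ = 0 ↔ p ∈ Set.range L) :
    mt y ω L t Set.univ ≤
      ENNReal.ofReal (8 * t ^ 2) * μH[2] (Metric.closedBall (0 : V2) 1) := by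
  rw [mt, (sg_emb ht hω hL).comap_apply, Set.image_univ]
  refine (measure_mono ?_).trans (sphere_le (y := y) ht hω hL)
  rintro _ ⟨v, rfl⟩
  exact sg_mem ht hω hL v

lemma sg_tendsto (hω : ‖ω‖ = 1) (hL : ∀ p : E3, ⟪p, ω⟫ = 0 ↔ p ∈ Set.range L) (v : V2) :
    Tendsto (fun t : ℝ => sg y ω L t v - t • ω) atTop (nhds (y - L v)) := by
  have e : ∀ t, sg y ω L t v - t • ω = y + (4 * t ^ 2 / (4 * t ^ 2 + ‖v‖ ^ 2) * (2 * t) - 2 * t) • ω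
      - (4 * t ^ 2 / (4 * t ^ 2 + ‖v‖ ^ 2)) • L v := fun t => by
    rw [sg_formula hω hL]; module
  have hi : Tendsto (fun t : ℝ => t⁻¹) atTop (nhds 0) := tendsto_inv_atTop_zero
  have h1 : Tendsto (fun t : ℝ => 4 * t ^ 2 / (4 * t ^ 2 + ‖v‖ ^ 2)) atTop (nhds 1) := by
    have : Tendsto (fun t : ℝ => 4 / (4 + ‖v‖ ^ 2 * t⁻¹ ^ 2)) atTop
        (nhds (4 / (4 + ‖v‖ ^ 2 * 0 ^ 2))) :=
      tendsto_const_nhds.div (tendsto_const_nhds.add ((hi.pow 2).const_mul _)) (by norm_num)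
    norm_num at this
    refine this.congr' ?_
    filter_upwards [eventually_gt_atTop 0] with t ht
    field_simp
  have h2 : Tendsto (fun t : ℝ => 4 * t ^ 2 / (4 * t ^ 2 + ‖v‖ ^ 2) * (2 * t) - 2 * t) atTop
      (nhds 0) := by
    have : Tendsto (fun t : ℝ => (4 * t ^ 2 / (4 * t ^ 2 + ‖v‖ ^ 2)) * (-‖v‖ ^ 2 / 2 * t⁻¹)) atTop
      (nhds (1 * (-‖v‖ ^ 2 / 2 * 0))) := h1.mul (hi.const_mul _)
    simp only [mul_zero] at this
    refine this.congr' ?_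
    filter_upwards [eventually_gt_atTop 0] with t ht
    have : 0 < 4 * t ^ 2 + ‖v‖ ^ 2 := by positivity
    field_simp
    ring
  simp only [e]
  have := (tendsto_const_nhds (x := y)).add (h2.smul_const ω) |>.sub (h1.smul_const (L v))
  simpa using this

end

section
variable {ν : ℝ → ℝ}

lemma nu_decay (hνc : ContinuousOn ν (Set.Ici 0)) (hν0 : ∀ r, 0 ≤ r → 0 ≤ ν r)
    (hνm : AntitoneOn ν (Set.Ici 0)) (hνi : IntegrableOn (fun r => r * ν r) (Set.Ioi 0)) :
    Tendsto (fun t : ℝ => ν (t / 2) * t ^ 2) atTop (nhds 0) := by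
  have h2 : Tendsto (fun t : ℝ => t / 2) atTop atTop := tendsto_id.atTop_div_const (by norm_num)
  have h4 : Tendsto (fun t : ℝ => t / 4) atTop atTop := tendsto_id.atTop_div_const (by norm_num)
  have a2 := intervalIntegral_tendsto_integral_Ioi 0 hνi h2
  have a4 := intervalIntegral_tendsto_integral_Ioi 0 hνi h4
  have hd := (a2.sub a4).const_mul 16
  rw [sub_self, mul_zero] at hd
  refine squeeze_zero' ?_ ?_ hd
  · filter_upwards [eventually_gt_atTop 0] with t ht
    exact mul_nonneg (hν0 _ (by positivity)) (by positivity)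
  · filter_upwards [eventually_gt_atTop 0] with t ht
    have hc : ContinuousOn (fun r => r * ν r) (Set.Ici 0) := continuousOn_id.mul hνc
    have ii : ∀ a b : ℝ, 0 ≤ a → 0 ≤ b → IntervalIntegrable (fun r => r * ν r) volume a b := by
      intro a b ha hb
      apply (hc.mono _).intervalIntegrable
      intro z hz
      exact (le_min ha hb).trans hz.1
    rw [intervalIntegral.integral_interval_sub_left (ii _ _ le_rfl (by positivity))
      (ii _ _ le_rfl (by positivity))]
    have := intervalIntegral.integral_mono_on (μ := volume) (a := t / 4) (b := t / 2)
      (f := fun _ => t / 4 * ν (t / 2)) (g := fun r => r * ν r) (by linarith)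
      (by simp) (ii _ _ (by positivity) (by positivity)) (fun s hs => by
        have hs1 := hs.1
        have hs0 : 0 ≤ s := by linarith
        exact mul_le_mul hs1 (hνm hs0 (by simp; positivity) hs.2) (hν0 _ (by positivity)) hs0)
    rw [intervalIntegral.integral_const, smul_eq_mul] at this
    nlinarith

/-- dominating function -/
noncomputable def GG (ν : ℝ → ℝ) (d : ℝ) (v : V2) : ℝ :=
  ν (‖v‖ / 4) + (Metric.closedBall (0 : V2) (4 * d)).indicator (fun _ => ν 0) v

lemma GG_nonneg (hν0 : ∀ r, 0 ≤ r → 0 ≤ ν r) (d : ℝ) (v : V2) : 0 ≤ GG ν d v :=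
  add_nonneg (hν0 _ (by positivity)) (Set.indicator_nonneg (fun _ _ => hν0 0 le_rfl) _)

lemma GG_int (hνi : IntegrableOn (fun r => r * ν r) (Set.Ioi 0)) (d : ℝ) :
    Integrable (GG ν d) (μH[2] : Measure V2) := by
  apply Integrable.add
  · have := integrable_fun_norm_addHaar (μH[2] : Measure V2) (f := fun r => ν (r / 4))
    rw [this, finrank_euclideanSpace_fin]
    have h := (integrableOn_Ioi_comp_mul_left_iff (fun r => r * ν r) 0 (a := 1 / 4)
      (by norm_num)).2 (by simpa using hνi)
    refine (h.const_mul 4).congr ?_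
    refine Eventually.of_forall fun r => ?_
    simp only [smul_eq_mul]
    rw [show (1:ℝ) / 4 * r = r / 4 by ring]; ring
  · rw [integrable_indicator_iff Metric.isClosed_closedBall.measurableSet]
    exact integrableOn_const (isCompact_closedBall _ _).measure_lt_top.ne

variable {x y ω : E3} {L : V2 →ₗᵢ[ℝ] E3} {t : ℝ}

lemma p_lower (v : V2) : dist (sg y ω L t v) (y + t • ω) - ‖x - y‖ ≤
    ‖x + t • ω - sg y ω L t v‖ := by
  have : x + t • ω - sg y ω L t v = (x - y) - (sg y ω L t v - (y + t • ω)) := by abel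
  rw [this, dist_eq_norm, norm_sub_rev (x - y)]
  exact norm_sub_norm_le _ _

lemma bound1 (hν0 : ∀ r, 0 ≤ r → 0 ≤ ν r)
    (hνm : AntitoneOn ν (Set.Ici 0)) (ht : 0 < t) (hω : ‖ω‖ = 1)
    (hL : ∀ p : E3, ⟪p, ω⟫ = 0 ↔ p ∈ Set.range L) {v : V2} (hv : ‖v‖ ≤ 2 * t) :
    ν ‖x + t • ω - sg y ω L t v‖ ≤ GG ν ‖x - y‖ v := by
  have h1 := near (y := y) ht hω hL hv
  have h2 := p_lower (x := x) (y := y) (ω := ω) (L := L) (t := t) v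
  rw [GG]
  by_cases hc : v ∈ Metric.closedBall (0 : V2) (4 * ‖x - y‖)
  · rw [Set.indicator_of_mem hc]
    have := hνm (a := 0) (by simp) (by simp) (norm_nonneg (x + t • ω - sg y ω L t v))
    have := hν0 (‖v‖ / 4) (by positivity)
    linarith
  · rw [Set.indicator_of_notMem hc, add_zero]
    rw [mem_closedBall_zero_iff, not_le] at hc
    exact hνm (by simp; positivity) (by simp) (by linarith)

lemma bound2 (hν0 : ∀ r, 0 ≤ r → 0 ≤ ν r)
    (hνm : AntitoneOn ν (Set.Ici 0)) (ht : 0 < t) (hd : 2 * ‖x - y‖ ≤ t) (hω : ‖ω‖ = 1)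
    (hL : ∀ p : E3, ⟪p, ω⟫ = 0 ↔ p ∈ Set.range L) (v : V2) :
    ν ‖x + t • ω - sg y ω L t v‖ ≤ GG ν ‖x - y‖ v + ν (t / 2) := by
  rcases le_total ‖v‖ (2 * t) with hv | hv
  · have := bound1 (x := x) (y := y) hν0 hνm ht hω hL hv
    have := hν0 (t / 2) (by positivity)
    linarith
  · have h1 := far (y := y) ht hω hL hv
    have h2 := p_lower (x := x) (y := y) (ω := ω) (L := L) (t := t) v
    have := GG_nonneg hν0 ‖x - y‖ v
    have := hνm (a := t / 2) (by simp; positivity) (by simp) 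
      (show t / 2 ≤ ‖x + t • ω - sg y ω L t v‖ by linarith)
    linarith

end

lemma abs_diff {lam m : Measure V2} (hm : m ≤ lam) {g : V2 → ℝ} (hg : Integrable g lam) :
    |∫ v, g v ∂m - ∫ v, g v ∂lam| ≤ ∫ v, |g v| ∂lam - ∫ v, |g v| ∂m := by
  have hgm := hg.mono_measure hm
  have h1 := integral_mono_measure (f := fun v => |g v| - g v) hm
    (Eventually.of_forall fun v => sub_nonneg.2 (le_abs_self _)) (hg.abs.sub hg)
  have h2 := integral_mono_measure (f := fun v => |g v| + g v) hm
    (Eventually.of_forall fun v => by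
      show 0 ≤ |g v| + g v
      linarith [neg_abs_le (g v)]) (hg.abs.add hg)
  rw [integral_sub hg.abs hg, integral_sub hgm.abs hgm] at h1
  rw [integral_add hg.abs hg, integral_add hgm.abs hgm] at h2
  rw [abs_le]
  constructor <;> linarith

lemma abs_core {lam m : Measure V2} [IsFiniteMeasure m] {B : Set V2} (hB : MeasurableSet B)
    (hm : m ≤ lam) {κ : ℝ} (hκ : 1 ≤ κ)
    (hge : lam.restrict B ≤ ENNReal.ofReal κ • m.restrict B) {g G : V2 → ℝ}
    (hG0 : ∀ v, 0 ≤ G v) (hGi : Integrable G lam) (hgc : Continuous g)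
    (hgB : ∀ v ∈ B, |g v| ≤ G v) {c : ℝ} (hc : 0 ≤ c) (hgb : ∀ v, |g v| ≤ G v + c) :
    |∫ v, g v ∂m - ∫ v in B, g v ∂lam| ≤
      (1 - 1 / κ) * ∫ v, G v ∂lam + ∫ v in Bᶜ, G v ∂lam + c * m.real Set.univ := by
  have hGm := hGi.mono_measure hm
  have hGc : Integrable (fun v => G v + c) m := hGm.add (integrable_const c)
  have hgm : Integrable g m := by
    refine hGc.mono' hgc.aestronglyMeasurable (Eventually.of_forall fun v => ?_)
    simpa using hgb v
  have hgl : IntegrableOn g B lam := by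
    refine (hGi.integrableOn (s := B)).mono' hgc.aestronglyMeasurable ?_
    filter_upwards [ae_restrict_mem hB] with v hv
    simpa using hgB v hv
  have hsplit := integral_add_compl hB hgm
  have hmB : m.restrict B ≤ lam.restrict B := Measure.restrict_mono le_rfl hm
  have h1 := abs_diff hmB hgl
  have hk := integral_mono_measure (f := fun v => |g v|) hge
    (Eventually.of_forall fun v => abs_nonneg _)
    ((hgm.abs.integrableOn (s := B)).smul_measure ENNReal.ofReal_ne_top)
  rw [integral_smul_measure, ENNReal.toReal_ofReal (by linarith), smul_eq_mul] at hk
  have h2 : ∫ v in B, |g v| ∂lam ≤ ∫ v, G v ∂lam := by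
    refine (setIntegral_mono_on hgl.abs hGi.integrableOn hB hgB).trans ?_
    exact setIntegral_le_integral hGi (Eventually.of_forall hG0)
  have h3 : |∫ v in Bᶜ, g v ∂m| ≤ ∫ v in Bᶜ, G v ∂lam + c * m.real Set.univ := by
    calc |∫ v in Bᶜ, g v ∂m| ≤ ∫ v in Bᶜ, |g v| ∂m := abs_integral_le_integral_abs
      _ ≤ ∫ v in Bᶜ, (G v + c) ∂m :=
        integral_mono hgm.abs.integrableOn hGc.integrableOn (fun v => hgb v)
      _ = ∫ v in Bᶜ, G v ∂m + ∫ v in Bᶜ, c ∂m :=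
        integral_add hGm.integrableOn (integrable_const c)
      _ ≤ _ := by
        gcongr
        · exact Eventually.of_forall hG0
        · exact hGi.integrableOn
        · rw [setIntegral_const, smul_eq_mul, mul_comm]
          exact mul_le_mul_of_nonneg_left (measureReal_mono (Set.subset_univ _)) hc
  have h4 : ∫ v in B, |g v| ∂lam - ∫ v in B, |g v| ∂m ≤ (1 - 1 / κ) * ∫ v, G v ∂lam := by
    have hκ0 : 0 < κ := by linarith
    have : 1 / κ * ∫ v in B, |g v| ∂lam ≤ ∫ v in B, |g v| ∂m := by
      rw [one_div, inv_mul_le_iff₀ hκ0]; exact hk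
    have h5 : 0 ≤ 1 - 1 / κ := by
      rw [sub_nonneg, div_le_one hκ0]; exact hκ
    nlinarith [mul_le_mul_of_nonneg_left h2 h5]
  rw [← hsplit]
  calc _ = |(∫ v in B, g v ∂m - ∫ v in B, g v ∂lam) + ∫ v in Bᶜ, g v ∂m| := by ring_nf
    _ ≤ _ := abs_add_le _ _
    _ ≤ _ := by linarith

section
variable {ν : ℝ → ℝ} {x y ω : E3} {L : V2 →ₗᵢ[ℝ] E3} {t : ℝ}

lemma mt_fin (ht : 0 < t) (hω : ‖ω‖ = 1) (hL : ∀ p : E3, ⟪p, ω⟫ = 0 ↔ p ∈ Set.range L) :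
    IsFiniteMeasure (mt y ω L t) :=
  ⟨(mt_univ_le ht hω hL).trans_lt
    (ENNReal.mul_lt_top ENNReal.ofReal_lt_top (isCompact_closedBall _ _).measure_lt_top)⟩

lemma mt_real (ht : 0 < t) (hω : ‖ω‖ = 1) (hL : ∀ p : E3, ⟪p, ω⟫ = 0 ↔ p ∈ Set.range L) :
    (mt y ω L t).real Set.univ ≤
      8 * t ^ 2 * (μH[2] : Measure V2).real (Metric.closedBall (0 : V2) 1) := by
  have := ENNReal.toReal_mono (ENNReal.mul_lt_top ENNReal.ofReal_lt_top
    (isCompact_closedBall _ _).measure_lt_top).ne (mt_univ_le (y := y) ht hω hL)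
  rwa [ENNReal.toReal_mul, ENNReal.toReal_ofReal (by positivity)] at this

lemma inner_bound (hνc : ContinuousOn ν (Set.Ici 0)) (hν0 : ∀ r, 0 ≤ r → 0 ≤ ν r)
    (hνm : AntitoneOn ν (Set.Ici 0)) (hνi : IntegrableOn (fun r => r * ν r) (Set.Ioi 0))
    (Q : E3 → E3 → ℝ) (hQb : ∀ x y, |Q x y| ≤ ν ‖x - y‖) (x y : E3) :
    ∃ C : ℝ, ∀ᶠ t : ℝ in atTop, ∀ ω : E3, ‖ω‖ = 1 →
      |∫ z in Metric.sphere y t, Q (x + t • ω) z ∂(μH[2])| ≤ C := by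
  set D := (μH[2] : Measure V2).real (Metric.closedBall (0 : V2) 1)
  refine ⟨∫ v, GG ν ‖x - y‖ v ∂(μH[2]) + 8 * D, ?_⟩
  have hdec := (nu_decay hνc hν0 hνm hνi).eventually (ge_mem_nhds (zero_lt_one))
  filter_upwards [eventually_gt_atTop 0, eventually_ge_atTop (2 * ‖x - y‖), hdec] with t ht hd hdt
  intro ω hω
  obtain ⟨L, hL⟩ := exists_L ω hω
  have := mt_fin (y := y) ht hω hL
  have hGi := GG_int hνi ‖x - y‖
  have hGm := hGi.mono_measure (mt_le (y := y) ht hω hL)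
  have hc := hν0 (t / 2) (by positivity)
  rw [integral_mt ht hω hL]
  calc |∫ v, Q (x + t • ω) (sg y ω L t v) ∂(mt y ω L t)|
      ≤ ∫ v, (GG ν ‖x - y‖ v + ν (t / 2)) ∂(mt y ω L t) := by
        rw [← Real.norm_eq_abs]
        refine norm_integral_le_of_norm_le (hGm.add (integrable_const _)) ?_
        refine Eventually.of_forall fun v => ?_
        exact (hQb _ _).trans (bound2 hν0 hνm ht hd hω hL v)
    _ = ∫ v, GG ν ‖x - y‖ v ∂(mt y ω L t) + ν (t / 2) * (mt y ω L t).real Set.univ := by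
        rw [integral_add hGm (integrable_const _), integral_const, smul_eq_mul, mul_comm]
    _ ≤ _ := by
        refine add_le_add (integral_mono_measure (mt_le ht hω hL)
          (Eventually.of_forall (GG_nonneg hν0 _)) hGi) ?_
        refine (mul_le_mul_of_nonneg_left (mt_real ht hω hL) hc).trans ?_
        have hD : 0 ≤ D := measureReal_nonneg
        calc _ = (ν (t / 2) * t ^ 2) * (8 * D) := by ring
          _ ≤ 1 * (8 * D) := by gcongr
          _ = _ := one_mul _

lemma inner_tendsto (hνc : ContinuousOn ν (Set.Ici 0)) (hν0 : ∀ r, 0 ≤ r → 0 ≤ ν r)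
    (hνm : AntitoneOn ν (Set.Ici 0)) (hνi : IntegrableOn (fun r => r * ν r) (Set.Ioi 0))
    (Q : E3 → E3 → ℝ) (hQc : Continuous fun p : E3 × E3 => Q p.1 p.2)
    (hQb : ∀ x y, |Q x y| ≤ ν ‖x - y‖) (q : E3 → ℝ) (hq : Continuous q) (a s : ℝ)
    (hQ : ∀ x y : E3, a < s * x 2 → a < s * y 2 → Q x y = q (x - y))
    (x y ω : E3) (hω : ‖ω‖ = 1) (hs : 0 < s * ω 2) :
    Tendsto (fun t : ℝ => ∫ z in Metric.sphere y t, Q (x + t • ω) z ∂(μH[2])) atTop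
      (nhds (∫ p in {p : E3 | ⟪p, ω⟫ = ⟪x - y, ω⟫}, q p ∂(μH[2]))) := by
  obtain ⟨L, hL⟩ := exists_L ω hω
  -- the planar integral
  have hplane : ∫ p in {p : E3 | ⟪p, ω⟫ = ⟪x - y, ω⟫}, q p ∂(μH[2])
      = ∫ v, q ((x - y) + L v) ∂(μH[2]) := by
    have hiso : Isometry (fun v : V2 => (x - y) + L v) :=
      (isometry_add_left (x - y)).comp L.isometry
    have hr : {p : E3 | ⟪p, ω⟫ = ⟪x - y, ω⟫} = Set.range (fun v : V2 => (x - y) + L v) := by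
      ext p
      have := hL (p - (x - y))
      rw [inner_sub_left, sub_eq_zero] at this
      rw [Set.mem_ofPred_eq, this]
      simp only [Set.mem_range]
      refine exists_congr fun v => ?_
      rw [eq_sub_iff_add_eq, add_comm]
    rw [hr, ← hiso.map_hausdorffMeasure (Or.inl (by norm_num)),
      (hiso.continuous.measurableEmbedding hiso.injective).integral_map]
  rw [hplane]
  set B : ℝ → Set V2 := fun t => {v | ‖v‖ ^ 2 ≤ t} with hBdef
  have hBm : ∀ t, MeasurableSet (B t) := fun t =>
    measurableSet_le (by fun_prop) (by fun_prop)
  set G := GG ν ‖x - y‖ with hGdef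
  have hG0 : ∀ v, 0 ≤ G v := GG_nonneg hν0 _
  have hGi : Integrable G μH[2] := GG_int hνi _
  set D := (μH[2] : Measure V2).real (Metric.closedBall (0 : V2) 1)
  set g : ℝ → V2 → ℝ := fun t v => Q (x + t • ω) (sg y ω L t v) with hg
  have hgcont : ∀ t, 0 < t → Continuous (g t) := fun t ht =>
    hQc.comp (Continuous.prodMk continuous_const (sg_lip ht hω hL).continuous)
  have hgB : ∀ t, 1 ≤ t → ∀ v ∈ B t, |g t v| ≤ G v := fun t ht v hv => by
    refine (hQb _ _).trans (bound1 hν0 hνm (by linarith) hω hL ?_)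
    have : ‖v‖ ^ 2 ≤ t := hv
    nlinarith [norm_nonneg v]
  -- pointwise convergence
  have hpt : ∀ v, Tendsto (fun t => g t v) atTop (nhds (q ((x - y) + L v))) := by
    intro v
    have h1 := sg_tendsto (y := y) hω hL v
    have h2 : Tendsto (fun t : ℝ => q (x - (sg y ω L t v - t • ω))) atTop
        (nhds (q (x - (y - L v)))) :=
      (hq.tendsto _).comp (tendsto_const_nhds.sub h1)
    rw [show x - (y - L v) = (x - y) + L v by abel] at h2
    refine h2.congr' ?_
    have hlin : Tendsto (fun t : ℝ => t * (s * ω 2)) atTop atTop :=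
      tendsto_id.atTop_mul_const hs
    have e1 : Tendsto (fun t : ℝ => s * (x + t • ω) 2) atTop atTop := by
      have := tendsto_atTop_add_const_left atTop (s * x 2) hlin
      refine this.congr fun t => ?_
      simp; ring
    have e2 : Tendsto (fun t : ℝ => s * (sg y ω L t v) 2) atTop atTop := by
      have h3 : Tendsto (fun t : ℝ => s * (sg y ω L t v - t • ω) 2) atTop
          (nhds (s * (y - L v) 2)) := by
        have hc : Continuous fun p : E3 => s * p 2 := by fun_prop
        exact (hc.tendsto _).comp h1
      refine (h3.add_atTop hlin).congr fun t => ?_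
      simp; ring
    filter_upwards [e1.eventually_gt_atTop a, e2.eventually_gt_atTop a] with t t1 t2
    rw [hg]
    simp only
    rw [hQ _ _ t1 t2]
    congr 1; abel
  have hBev : ∀ v, ∀ᶠ t in atTop, v ∈ B t := fun v => eventually_ge_atTop (‖v‖ ^ 2)
  have hmain : Tendsto (fun t => ∫ v in B t, g t v ∂(μH[2])) atTop
      (nhds (∫ v, q ((x - y) + L v) ∂(μH[2]))) := by
    simp_rw [← integral_indicator (hBm _)]
    refine tendsto_integral_filter_of_dominated_convergence G ?_ ?_ hGi ?_
    · filter_upwards [eventually_gt_atTop 0] with t ht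
      exact ((hgcont t ht).measurable.indicator (hBm t)).aestronglyMeasurable
    · filter_upwards [eventually_ge_atTop 1] with t ht
      refine Eventually.of_forall fun v => ?_
      by_cases hv : v ∈ B t
      · rw [Set.indicator_of_mem hv]; exact hgB t ht v hv
      · rw [Set.indicator_of_notMem hv]; simpa using hG0 v
    · refine Eventually.of_forall fun v => ?_
      refine (hpt v).congr' ?_
      filter_upwards [hBev v] with t hv
      rw [Set.indicator_of_mem hv]
  have htail : Tendsto (fun t => ∫ v in (B t)ᶜ, G v ∂(μH[2])) atTop (nhds 0) := by
    simp_rw [← integral_indicator (hBm _).compl]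
    rw [← integral_zero V2 ℝ (μ := μH[2])]
    refine tendsto_integral_filter_of_dominated_convergence G ?_ ?_ hGi ?_
    · exact Eventually.of_forall fun t => hGi.aestronglyMeasurable.indicator (hBm t).compl
    · refine Eventually.of_forall fun t => Eventually.of_forall fun v => ?_
      rw [Real.norm_eq_abs, abs_of_nonneg (Set.indicator_nonneg (fun v _ => hG0 v) _)]
      exact Set.indicator_le_self' (fun v _ => hG0 v) _
    · refine Eventually.of_forall fun v => ?_
      refine tendsto_const_nhds.congr' ?_
      filter_upwards [hBev v] with t hv
      rw [Set.indicator_of_notMem (by simpa using hv)]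
  have hκ : Tendsto (fun t : ℝ => (1 - 1 / (1 + 1 / (4 * t)) ^ 2) * ∫ v, G v ∂(μH[2])) atTop
      (nhds 0) := by
    have h4 : Tendsto (fun t : ℝ => 1 / (4 * t)) atTop (nhds 0) :=
      tendsto_const_nhds.div_atTop (tendsto_id.const_mul_atTop (by norm_num))
    have : Tendsto (fun t : ℝ => (1 - 1 / (1 + 1 / (4 * t)) ^ 2) * ∫ v, G v ∂(μH[2])) atTop
      (nhds ((1 - 1 / (1 + 0) ^ 2) * ∫ v, G v ∂(μH[2]))) :=
      (tendsto_const_nhds.sub (tendsto_const_nhds.div ((tendsto_const_nhds.add h4).pow 2)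
        (by norm_num))).mul_const _
    simpa using this
  have hdec : Tendsto (fun t : ℝ => ν (t / 2) * t ^ 2 * (8 * D)) atTop (nhds 0) := by
    simpa using (nu_decay hνc hν0 hνm hνi).mul_const (8 * D)
  have hdiff : Tendsto (fun t => ∫ z in Metric.sphere y t, Q (x + t • ω) z ∂(μH[2])
      - ∫ v in B t, g t v ∂(μH[2])) atTop (nhds 0) := by
    have hsum := (hκ.add htail).add hdec
    rw [add_zero, add_zero] at hsum
    refine squeeze_zero_norm' ?_ hsum
    filter_upwards [eventually_ge_atTop 1, eventually_ge_atTop (2 * ‖x - y‖)] with t ht1 hd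
    have ht : 0 < t := by linarith
    have := mt_fin (y := y) ht hω hL
    have hc := hν0 (t / 2) (by positivity)
    rw [integral_mt ht hω hL]
    have h1 : (1:ℝ) ≤ (1 + 1 / (4 * t)) ^ 2 := by
      apply one_le_pow₀
      have : 0 ≤ 1 / (4 * t) := by positivity
      linarith
    have := abs_core (hBm t) (mt_le ht hω hL) h1 (mt_ge (y := y) ht hω hL) hG0 hGi (hgcont t ht)
      (hgB t ht1) hc (fun v => (hQb _ _).trans (bound2 hν0 hνm ht hd hω hL v))
    refine this.trans ?_
    have h2 := mul_le_mul_of_nonneg_left (mt_real (y := y) ht hω hL) hc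
    have h3 : ν (t / 2) * (8 * t ^ 2 * D) = ν (t / 2) * t ^ 2 * (8 * D) := by ring
    rw [← h3]
    gcongr
  simpa using hdiff.add hmain

lemma sphere_fin (y : E3) {t : ℝ} (ht : 0 < t) : μH[2] (Metric.sphere y t) < ∞ := by
  have hω : ‖(EuclideanSpace.single 0 1 : E3)‖ = 1 := by simp
  obtain ⟨L, hL⟩ := exists_L _ hω
  exact (sphere_le ht hω hL).trans_lt
    (ENNReal.mul_lt_top ENNReal.ofReal_lt_top (isCompact_closedBall _ _).measure_lt_top)

lemma half (hνc : ContinuousOn ν (Set.Ici 0)) (hν0 : ∀ r, 0 ≤ r → 0 ≤ ν r)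
    (hνm : AntitoneOn ν (Set.Ici 0)) (hνi : IntegrableOn (fun r => r * ν r) (Set.Ioi 0))
    (Q : E3 → E3 → ℝ) (hQc : Continuous fun p : E3 × E3 => Q p.1 p.2)
    (hQb : ∀ x y, |Q x y| ≤ ν ‖x - y‖) (q : E3 → ℝ) (hq : Continuous q) (a s : ℝ)
    (hQ : ∀ x y : E3, a < s * x 2 → a < s * y 2 → Q x y = q (x - y))
    (x y : E3) :
    Tendsto (fun t : ℝ => ∫ ω in {ω : E3 | ‖ω‖ = 1 ∧ 0 < s * ω 2},
        (∫ z in Metric.sphere y t, Q (x + t • ω) z ∂(μH[2])) ∂(μH[2])) atTop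
      (nhds (∫ ω in {ω : E3 | ‖ω‖ = 1 ∧ 0 < s * ω 2},
        (∫ p in {p : E3 | ⟪p, ω⟫ = ⟪x - y, ω⟫}, q p ∂(μH[2])) ∂(μH[2]))) := by
  have hHm : MeasurableSet {ω : E3 | ‖ω‖ = 1 ∧ 0 < s * ω 2} := by
    have h1 : MeasurableSet {ω : E3 | ‖ω‖ = 1} :=
      measurableSet_eq_fun (by fun_prop) (by fun_prop)
    have h2 : MeasurableSet {ω : E3 | 0 < s * ω 2} :=
      measurableSet_lt (by fun_prop) (by fun_prop)
    exact h1.inter h2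
  have hfin : μH[2] {ω : E3 | ‖ω‖ = 1 ∧ 0 < s * ω 2} < ∞ := by
    refine (measure_mono ?_).trans_lt (sphere_fin (0 : E3) one_pos)
    intro ω hω
    simpa using hω.1
  obtain ⟨C, hC⟩ := inner_bound hνc hν0 hνm hνi Q hQb x y
  refine tendsto_integral_filter_of_dominated_convergence (fun _ => C) ?_ ?_
    (integrableOn_const hfin.ne) ?_
  · filter_upwards [eventually_gt_atTop 0] with t ht
    have : IsFiniteMeasure ((μH[2] : Measure E3).restrict (Metric.sphere y t)) :=
      ⟨by simpa using sphere_fin y ht⟩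
    have hcont : Continuous (fun p : E3 × E3 => Q (x + t • p.1) p.2) :=
      hQc.comp (Continuous.prodMk (by fun_prop) (by fun_prop))
    exact (hcont.stronglyMeasurable.integral_prod_right'
      (ν := (μH[2] : Measure E3).restrict (Metric.sphere y t))).aestronglyMeasurable
  · filter_upwards [hC] with t ht
    filter_upwards [ae_restrict_mem hHm] with ω hω
    exact ht ω hω.1
  · filter_upwards [ae_restrict_mem hHm] with ω hω
    exact inner_tendsto hνc hν0 hνm hνi Q hQc hQb q hq a s hQ x y ω hω.1 hω.2

end

end CSI

/-- Lemma 3.2 of the paper (convergence of correlation functions): if `Q(x,y)` is continuous,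
bounded by `ν(|x-y|)`, and coincides with `q₋(x-y)` (resp. `q₊(x-y)`) when both third
coordinates are `< -a` (resp. `> a`), then the spherical integral
`(1/(4π)²) ∫_{|ω|=1, ±ω₃>0} ∫_{S_t(y)} Q(x+tω, y') dH²(y') dS(ω)` converges, as `t → ∞`,
to the corresponding half-sphere average of planar integrals of `q∓`. -/
theorem correlation_spherical_integral_tendsto
    (ν : ℝ → ℝ) (hνc : ContinuousOn ν (Set.Ici 0))
    (hν0 : ∀ r, 0 ≤ r → 0 ≤ ν r) (hνm : AntitoneOn ν (Set.Ici 0))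
    (hνi : MeasureTheory.IntegrableOn (fun r => r * ν r) (Set.Ioi 0))
    (a : ℝ) (ha : 0 < a)
    (qm qp : EuclideanSpace ℝ (Fin 3) → ℝ) (hqmc : Continuous qm) (hqpc : Continuous qp)
    (hqmb : ∀ z, |qm z| ≤ ν ‖z‖) (hqpb : ∀ z, |qp z| ≤ ν ‖z‖)
    (Q : EuclideanSpace ℝ (Fin 3) → EuclideanSpace ℝ (Fin 3) → ℝ)
    (hQc : Continuous fun p : EuclideanSpace ℝ (Fin 3) × EuclideanSpace ℝ (Fin 3) => Q p.1 p.2)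
    (hQb : ∀ x y, |Q x y| ≤ ν ‖x - y‖)
    (hQm : ∀ x y : EuclideanSpace ℝ (Fin 3), x 2 < -a → y 2 < -a → Q x y = qm (x - y))
    (hQp : ∀ x y : EuclideanSpace ℝ (Fin 3), a < x 2 → a < y 2 → Q x y = qp (x - y))
    (x y : EuclideanSpace ℝ (Fin 3)) :
    (Tendsto (fun t : ℝ =>
        (1 / (4 * Real.pi) ^ 2) *
          ∫ ω in {ω : EuclideanSpace ℝ (Fin 3) | ‖ω‖ = 1 ∧ ω 2 < 0},
            (∫ y' in Metric.sphere y t, Q (x + t • ω) y' ∂(μH[2])) ∂(μH[2]))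
      atTop (nhds
        ((1 / (4 * Real.pi) ^ 2) *
          ∫ ω in {ω : EuclideanSpace ℝ (Fin 3) | ‖ω‖ = 1 ∧ ω 2 < 0},
            (∫ p in {p : EuclideanSpace ℝ (Fin 3) | ⟪p, ω⟫ = ⟪x - y, ω⟫},
              qm p ∂(μH[2])) ∂(μH[2])))) ∧
    (Tendsto (fun t : ℝ =>
        (1 / (4 * Real.pi) ^ 2) *
          ∫ ω in {ω : EuclideanSpace ℝ (Fin 3) | ‖ω‖ = 1 ∧ 0 < ω 2},
            (∫ y' in Metric.sphere y t, Q (x + t • ω) y' ∂(μH[2])) ∂(μH[2]))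
      atTop (nhds
        ((1 / (4 * Real.pi) ^ 2) *
          ∫ ω in {ω : EuclideanSpace ℝ (Fin 3) | ‖ω‖ = 1 ∧ 0 < ω 2},
            (∫ p in {p : EuclideanSpace ℝ (Fin 3) | ⟪p, ω⟫ = ⟪x - y, ω⟫},
              qp p ∂(μH[2])) ∂(μH[2])))) := by
  have hm := CSI.half hνc hν0 hνm hνi Q hQc hQb qm hqmc a (-1)
    (fun x y hx hy => hQm x y (by linarith) (by linarith)) x y
  have hp := CSI.half hνc hν0 hνm hνi Q hQc hQb qp hqpc a 1
    (fun x y hx hy => hQp x y (by linarith) (by linarith)) x y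
  have e : ∀ r : ℝ, 0 < -1 * r ↔ r < 0 := fun r => by
    constructor <;> intro h <;> linarith
  simp only [one_mul] at hp
  simp only [e] at hm
  exact ⟨hm.const_mul _, hp.const_mul _⟩
end
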